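/- arXiv:2510.06792 — 3 statements merged into one kernel-verified Lean document; each statement's English description precedes it below -/
import Mathlib

section
/- Fix s ∈ ℂ with s² ≠ 4 and define F : ℂ × ℂ² → ℂ by F(t,(x,y)) = x⁴ + s x²y³ + t x²y⁴ + y⁶ (the family W_{1,0}). Then F is Lipschitz trivial in t over ℂ: for every t₀ ∈ ℂ there exist a neighborhood T of t₀ in ℂ, a radius r > 0, a constant L ≥ 1, and a continuous map H : T × B(0,r) → ℂ² such that for each t ∈ T: H(t,0) = 0; L⁻¹‖p − q‖ ≤ ‖H(t,p) − H(t,q)‖ ≤ L‖p − q‖ for all p, q ∈ B(0,r); the image H(t, B(0,r)) is a neighborhood of 0 in ℂ²; and F(t, H(t,p)) = F(t₀, p) for all p ∈ B(0,r). -/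
open Filter

/-- The monomial `z ^ i * conj z ^ j` is Lipschitz on a disc, with constant given by its degree. -/
lemma norm_pow_mul_conj_pow_sub_le (i j : ℕ) {z w : ℂ} (h : ‖w‖ ≤ ‖z‖) :
    ‖z ^ i * starRingEnd ℂ z ^ j - w ^ i * starRingEnd ℂ w ^ j‖ ≤
      (i + j : ℕ) * ‖z‖ ^ (i + j - 1) * ‖z - w‖ := by
  have step (n : ℕ) (a b A B : ℂ) (ha : ‖a‖ = ‖z‖) (hab : ‖a - b‖ = ‖z - w‖)
      (hB : ‖B‖ = ‖w‖ ^ n) (hAB : ‖A - B‖ ≤ n * ‖z‖ ^ (n - 1) * ‖z - w‖) :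
      ‖a * A - b * B‖ ≤ (n + 1 : ℕ) * ‖z‖ ^ n * ‖z - w‖ := by
    have hpow : ‖z‖ * (n * ‖z‖ ^ (n - 1)) = n * ‖z‖ ^ n := by
      rcases n with _ | n
      · simp
      · simp only [Nat.add_sub_cancel]; ring
    calc ‖a * A - b * B‖ = ‖a * (A - B) + (a - b) * B‖ := by ring_nf
      _ ≤ ‖z‖ * (n * ‖z‖ ^ (n - 1) * ‖z - w‖) + ‖z - w‖ * ‖z‖ ^ n := by
        refine (norm_add_le _ _).trans (add_le_add ?_ ?_)
        · rw [norm_mul, ha]; gcongr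
        · rw [norm_mul, hab, hB]; gcongr
      _ = (n + 1 : ℕ) * ‖z‖ ^ n * ‖z - w‖ := by
        rw [← mul_assoc, hpow]; push_cast; ring
  induction i with
  | zero =>
    induction j with
    | zero => simp
    | succ j ih =>
      have := step j (starRingEnd ℂ z) (starRingEnd ℂ w) (starRingEnd ℂ z ^ j)
        (starRingEnd ℂ w ^ j) (by simp) (by rw [← map_sub, RCLike.norm_conj]) (by simp)
        (by simpa using ih)
      simpa [pow_succ'] using this
  | succ i ih =>
    have := step (i + j) z w _ _ rfl rfl (by simp [pow_add]) ih
    rw [show i + 1 + j - 1 = i + j by lia, show i + 1 + j = i + j + 1 by ring]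
    simpa [pow_succ', mul_assoc] using this

lemma norm_pow_sub_norm_pow_le (n : ℕ) {z w : ℂ} (h : ‖w‖ ≤ ‖z‖) :
    ‖z‖ ^ n - ‖w‖ ^ n ≤ n * ‖z‖ ^ (n - 1) * ‖z - w‖ := by
  have h₁ := norm_pow_mul_conj_pow_sub_le n 0 h
  have h₂ := norm_sub_norm_le (z ^ n) (w ^ n)
  simp only [norm_pow] at h₂
  simp only [pow_zero, mul_one, add_zero] at h₁
  exact h₂.trans h₁

/-- Monomials of weighted degree at least `12`, for the weights `(3, 2)`, are dominated by
`a ^ 4 + b ^ 6` on the unit square. -/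
lemma pow_mul_pow_le_of_weight {a b : ℝ} (ha : 0 ≤ a) (ha₁ : a ≤ 1) (hb : 0 ≤ b) (hb₁ : b ≤ 1)
    {n m : ℕ} (h : 12 ≤ 3 * n + 2 * m) : a ^ n * b ^ m ≤ a ^ 4 + b ^ 6 := by
  set α := a ^ (1 / 3 : ℝ) with hα
  set β := b ^ (1 / 2 : ℝ) with hβ
  have hα₀ : 0 ≤ α := by positivity
  have hβ₀ : 0 ≤ β := by positivity
  have hαa : α ^ 3 = a := by rw [hα, ← Real.rpow_natCast, ← Real.rpow_mul ha]; norm_num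
  have hβb : β ^ 2 = b := by rw [hβ, ← Real.rpow_natCast, ← Real.rpow_mul hb]; norm_num
  have hα₁ : α ≤ 1 := Real.rpow_le_one ha ha₁ (by norm_num)
  have hβ₁ : β ≤ 1 := Real.rpow_le_one hb hb₁ (by norm_num)
  have key : ∀ γ : ℝ, α ≤ γ → β ≤ γ → γ ≤ 1 → a ^ n * b ^ m ≤ γ ^ 12 := by
    intro γ h₁ h₂ h₃
    have hγ : 0 ≤ γ := hα₀.trans h₁
    calc a ^ n * b ^ m = α ^ (3 * n) * β ^ (2 * m) := by rw [pow_mul, pow_mul, hαa, hβb]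
      _ ≤ γ ^ (3 * n) * γ ^ (2 * m) := by gcongr
      _ = γ ^ (3 * n + 2 * m) := (pow_add _ _ _).symm
      _ ≤ γ ^ 12 := pow_le_pow_of_le_one hγ h₃ h
  have ha4 : α ^ 12 = a ^ 4 := by rw [← hαa]; ring
  have hb6 : β ^ 12 = b ^ 6 := by rw [← hβb]; ring
  rcases le_total α β with hab | hab
  · have := key β hab le_rfl hβ₁
    have : 0 ≤ a ^ 4 := by positivity
    linarith
  · have := key α le_rfl hab hα₁
    have : 0 ≤ b ^ 6 := by positivity
    linarith

lemma norm_div_sub_div_le {N N' m C₁ C₂ δ : ℝ} {u u' : ℂ} (hN' : 0 ≤ N') (hN : N' ≤ N)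
    (hδ : 0 ≤ δ) (hC₁ : 0 ≤ C₁) (hC₂ : 0 ≤ C₂)
    (hu' : ‖u'‖ ≤ m * N') (huu' : ‖u - u'‖ ≤ C₁ * N * δ) (hm : m * (N - N') ≤ C₂ * N * δ) :
    ‖u / N - u' / N'‖ ≤ (C₁ + C₂) * δ := by
  rcases hN'.eq_or_lt with h0 | h0
  · subst h0
    have hu0 : u' = 0 := by simpa using hu'
    subst hu0
    rcases hN.eq_or_lt with hN0 | hN0
    · subst hN0; simp; positivity
    · rw [sub_zero] at huu'
      simp only [zero_div, sub_zero, norm_div, Complex.norm_real, Real.norm_of_nonneg hN0.le]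
      rw [div_le_iff₀ hN0]
      nlinarith [mul_nonneg (mul_nonneg hC₂ hδ) hN0.le]
  · have hN0 : 0 < N := h0.trans_le hN
    have hNc : (N : ℂ) ≠ 0 := by exact_mod_cast hN0.ne'
    have hNc' : (N' : ℂ) ≠ 0 := by exact_mod_cast h0.ne'
    have e : u / N - u' / N' = (u - u') / N - u' / N' * (((N - N' : ℝ) : ℂ) / N) := by
      push_cast; field_simp; ring
    have h₁ : ‖(u - u') / N‖ ≤ C₁ * δ := by
      rw [norm_div, Complex.norm_real, Real.norm_of_nonneg hN0.le, div_le_iff₀ hN0]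
      linarith
    have h₂ : ‖u' / N' * (((N - N' : ℝ) : ℂ) / N)‖ ≤ C₂ * δ := by
      rw [norm_mul, norm_div, norm_div, Complex.norm_real, Complex.norm_real, Complex.norm_real,
        Real.norm_of_nonneg hN0.le, Real.norm_of_nonneg h0.le, Real.norm_of_nonneg (by linarith)]
      calc ‖u'‖ / N' * ((N - N') / N) ≤ m * ((N - N') / N) := by
            gcongr
            rwa [div_le_iff₀ h0]
        _ = m * (N - N') / N := by ring
        _ ≤ C₂ * δ := by rw [div_le_iff₀ hN0]; linarith
    rw [e]
    linarith [norm_sub_le ((u - u') / N) (u' / N' * (((N - N' : ℝ) : ℂ) / N))]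

/-- A monomial in `x, conj x, y, conj y` divided by the weighted gauge `‖x‖ ^ 4 + ‖y‖ ^ 6`. -/
noncomputable def gaugeQuotient (i j k l : ℕ) (p : ℂ × ℂ) : ℂ :=
  (p.1 ^ i * starRingEnd ℂ p.1 ^ j) * (p.2 ^ k * starRingEnd ℂ p.2 ^ l) /
    ((‖p.1‖ ^ 4 + ‖p.2‖ ^ 6 : ℝ) : ℂ)

lemma lipschitzOnWith_of_separately {g : ℂ × ℂ → ℂ} {C : NNReal}
    (hx : ∀ x x' y : ℂ, ‖x'‖ ≤ ‖x‖ → ‖x‖ ≤ 1 → ‖y‖ ≤ 1 → ‖g (x, y) - g (x', y)‖ ≤ C * ‖x - x'‖)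
    (hy : ∀ x y y' : ℂ, ‖y'‖ ≤ ‖y‖ → ‖y‖ ≤ 1 → ‖x‖ ≤ 1 → ‖g (x, y) - g (x, y')‖ ≤ C * ‖y - y'‖) :
    LipschitzOnWith (2 * C) g (Metric.closedBall 0 1) := by
  have hx' (x x' y : ℂ) (h : ‖x‖ ≤ 1) (h' : ‖x'‖ ≤ 1) (h'' : ‖y‖ ≤ 1) :
      ‖g (x, y) - g (x', y)‖ ≤ C * ‖x - x'‖ := by
    rcases le_total ‖x'‖ ‖x‖ with hle | hle
    · exact hx x x' y hle h h''
    · rw [norm_sub_rev, norm_sub_rev x]; exact hx x' x y hle h' h''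
  have hy' (x y y' : ℂ) (h : ‖y‖ ≤ 1) (h' : ‖y'‖ ≤ 1) (h'' : ‖x‖ ≤ 1) :
      ‖g (x, y) - g (x, y')‖ ≤ C * ‖y - y'‖ := by
    rcases le_total ‖y'‖ ‖y‖ with hle | hle
    · exact hy x y y' hle h h''
    · rw [norm_sub_rev, norm_sub_rev y]; exact hy x y' y hle h' h''
  rw [lipschitzOnWith_iff_norm_sub_le]
  rintro ⟨x, y⟩ hp ⟨x', y'⟩ hq
  rw [mem_closedBall_zero_iff, Prod.norm_def, max_le_iff] at hp hq
  have h₁ := hx' x x' y hp.1 hq.1 hp.2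
  have h₂ := hy' x' y y' hp.2 hq.2 hq.1
  have h₃ : ‖x - x'‖ ≤ ‖(x, y) - (x', y')‖ := norm_fst_le ((x, y) - (x', y'))
  have h₄ : ‖y - y'‖ ≤ ‖(x, y) - (x', y')‖ := norm_snd_le ((x, y) - (x', y'))
  have h₅ := norm_sub_le_norm_sub_add_norm_sub (g (x, y)) (g (x', y)) (g (x', y'))
  push_cast
  nlinarith [C.2, mul_le_mul_of_nonneg_left h₃ C.2, mul_le_mul_of_nonneg_left h₄ C.2]

/-- A sufficient condition for `gaugeQuotient` to be Lipschitz near the origin, in terms of weighted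
degrees: it is bounded by `‖x‖ ^ p * ‖y‖ ^ q`, and its first derivatives are bounded. -/
lemma gaugeQuotient_lipschitzOnWith {i j k l p q : ℕ} (hp : p ≤ i + j) (hq : q ≤ k + l)
    (h : 12 ≤ 3 * (i + j - p) + 2 * (k + l - q)) (hx : 12 ≤ 3 * (i + j - 1) + 2 * (k + l))
    (hy : 12 ≤ 3 * (i + j) + 2 * (k + l - 1)) (hpq : 12 ≤ 3 * (p + 3) + 2 * q)
    (hpq' : 12 ≤ 3 * p + 2 * (q + 5)) :
    ∃ K, LipschitzOnWith K (gaugeQuotient i j k l) (Metric.closedBall 0 1) := by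
  have hmul (z : ℂ) (i j : ℕ) : ‖z ^ i * starRingEnd ℂ z ^ j‖ = ‖z‖ ^ (i + j) := by
    simp [pow_add]
  have hmain (x y : ℂ) (h₁ : ‖x‖ ≤ 1) (h₂ : ‖y‖ ≤ 1) : ‖x‖ ^ (i + j) * ‖y‖ ^ (k + l) ≤
      ‖x‖ ^ p * ‖y‖ ^ q * (‖x‖ ^ 4 + ‖y‖ ^ 6) := by
    have := pow_mul_pow_le_of_weight (norm_nonneg x) h₁ (norm_nonneg y) h₂ h
    calc _ = ‖x‖ ^ p * ‖y‖ ^ q * (‖x‖ ^ (i + j - p) * ‖y‖ ^ (k + l - q)) := by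
          nth_rw 1 [← Nat.add_sub_cancel' hp, ← Nat.add_sub_cancel' hq]
          rw [pow_add, pow_add]; ring
      _ ≤ _ := by gcongr
  refine ⟨_, lipschitzOnWith_of_separately (C := (i + j : ℕ) + (k + l : ℕ) + 6) ?_ ?_⟩
  · intro x x' y hxx h₁ h₂
    have h₁' := hxx.trans h₁
    have A := pow_mul_pow_le_of_weight (norm_nonneg x) h₁ (norm_nonneg y) h₂ hx
    have B := pow_mul_pow_le_of_weight (norm_nonneg x) h₁ (norm_nonneg y) h₂ hpq
    have key := norm_div_sub_div_le (N := ‖x‖ ^ 4 + ‖y‖ ^ 6) (N' := ‖x'‖ ^ 4 + ‖y‖ ^ 6)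
      (m := ‖x‖ ^ p * ‖y‖ ^ q) (C₁ := (i + j : ℕ)) (C₂ := 4) (δ := ‖x - x'‖)
      (u := (x ^ i * starRingEnd ℂ x ^ j) * (y ^ k * starRingEnd ℂ y ^ l))
      (u' := (x' ^ i * starRingEnd ℂ x' ^ j) * (y ^ k * starRingEnd ℂ y ^ l))
      (by positivity) (by gcongr) (by positivity) (by positivity) (by positivity) ?_ ?_ ?_
    · refine key.trans ?_
      push_cast
      gcongr ?_ * _
      have : (0 : ℝ) ≤ (k : ℝ) + l := by positivity
      linarith
    · rw [norm_mul, hmul, hmul]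
      refine (hmain x' y h₁' h₂).trans ?_
      gcongr
    · rw [← sub_mul, norm_mul, hmul]
      calc _ ≤ (i + j : ℕ) * ‖x‖ ^ (i + j - 1) * ‖x - x'‖ * ‖y‖ ^ (k + l) := by
            gcongr; exact norm_pow_mul_conj_pow_sub_le i j hxx
        _ = (i + j : ℕ) * (‖x‖ ^ (i + j - 1) * ‖y‖ ^ (k + l)) * ‖x - x'‖ := by ring
        _ ≤ _ := by gcongr
    · have := norm_pow_sub_norm_pow_le 4 hxx
      calc _ = ‖x‖ ^ p * ‖y‖ ^ q * (‖x‖ ^ 4 - ‖x'‖ ^ 4) := by ring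
        _ ≤ ‖x‖ ^ p * ‖y‖ ^ q * ((4 : ℕ) * ‖x‖ ^ 3 * ‖x - x'‖) := by gcongr
        _ = 4 * (‖x‖ ^ (p + 3) * ‖y‖ ^ q) * ‖x - x'‖ := by push_cast; ring
        _ ≤ _ := by gcongr
  · intro x y y' hyy h₂ h₁
    have h₂' := hyy.trans h₂
    have A := pow_mul_pow_le_of_weight (norm_nonneg x) h₁ (norm_nonneg y) h₂ hy
    have B := pow_mul_pow_le_of_weight (norm_nonneg x) h₁ (norm_nonneg y) h₂ hpq'
    have key := norm_div_sub_div_le (N := ‖x‖ ^ 4 + ‖y‖ ^ 6) (N' := ‖x‖ ^ 4 + ‖y'‖ ^ 6)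
      (m := ‖x‖ ^ p * ‖y‖ ^ q) (C₁ := (k + l : ℕ)) (C₂ := 6) (δ := ‖y - y'‖)
      (u := (x ^ i * starRingEnd ℂ x ^ j) * (y ^ k * starRingEnd ℂ y ^ l))
      (u' := (x ^ i * starRingEnd ℂ x ^ j) * (y' ^ k * starRingEnd ℂ y' ^ l))
      (by positivity) (by gcongr) (by positivity) (by positivity) (by positivity) ?_ ?_ ?_
    · refine key.trans ?_
      push_cast
      gcongr ?_ * _
      have : (0 : ℝ) ≤ (i : ℝ) + j := by positivity
      linarith
    · rw [norm_mul, hmul, hmul]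
      refine (hmain x y' h₁ h₂').trans ?_
      gcongr
    · rw [← mul_sub, norm_mul, hmul]
      calc _ ≤ ‖x‖ ^ (i + j) * ((k + l : ℕ) * ‖y‖ ^ (k + l - 1) * ‖y - y'‖) := by
            gcongr; exact norm_pow_mul_conj_pow_sub_le k l hyy
        _ = (k + l : ℕ) * (‖x‖ ^ (i + j) * ‖y‖ ^ (k + l - 1)) * ‖y - y'‖ := by ring
        _ ≤ _ := by gcongr
    · have := norm_pow_sub_norm_pow_le 6 hyy
      calc _ = ‖x‖ ^ p * ‖y‖ ^ q * (‖y‖ ^ 6 - ‖y'‖ ^ 6) := by ring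
        _ ≤ ‖x‖ ^ p * ‖y‖ ^ q * ((6 : ℕ) * ‖y‖ ^ 5 * ‖y - y'‖) := by gcongr
        _ = 6 * (‖x‖ ^ p * ‖y‖ ^ (q + 5)) * ‖y - y'‖ := by push_cast; ring
        _ ≤ _ := by gcongr

/-- Local flow of a Lipschitz autonomous vector field, for nonnegative times so short that the
displacement from the starting point is `1 / 2`-Lipschitz. -/
lemma exists_local_flow_of_lipschitzOnWith {E : Type*} [NormedAddCommGroup E] [NormedSpace ℝ E]
    [CompleteSpace E] {f : E → E} {x₀ : E} {a : ℝ} (ha : 0 < a) {K : NNReal}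
    (hf : LipschitzOnWith K f (Metric.closedBall x₀ a)) :
    ∃ r > 0, ∃ ε > 0, ∃ α : E → ℝ → E,
      (∀ x ∈ Metric.closedBall x₀ r, α x 0 = x ∧ ∀ t ∈ Set.Icc 0 ε,
        α x t ∈ Metric.closedBall x₀ a ∧ HasDerivWithinAt (α x) (f (α x t)) (Set.Icc 0 ε) t) ∧
      ∀ x ∈ Metric.closedBall x₀ r, ∀ y ∈ Metric.closedBall x₀ r,
        ‖(α x ε - x) - (α y ε - y)‖ ≤ 1 / 2 * ‖x - y‖ := by
  lift a to NNReal using ha.le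
  have ha' : 0 < a := by exact_mod_cast ha
  set L : NNReal := K * a + ‖f x₀‖₊ + 1 with hL
  have hL0 : 0 < L := by positivity
  have hb (x : E) (hx : x ∈ Metric.closedBall x₀ a) : ‖f x‖ ≤ L := by
    have h₁ := hf.norm_sub_le hx (Metric.mem_closedBall_self a.2)
    have h₂ : ‖x - x₀‖ ≤ a := by simpa [dist_eq_norm] using hx
    have h₃ := norm_le_norm_sub_add (f x) (f x₀)
    have h₄ : K * ‖x - x₀‖ ≤ K * (a : ℝ) := by gcongr
    simp only [hL]
    push_cast
    linarith
  set ε₀ : ℝ := a / 2 / L with hε₀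
  have hε₀pos : 0 < ε₀ := by positivity
  have hPL : IsPicardLindelof (fun _ ↦ f) (tmin := 0) (tmax := ε₀) ⟨0, le_rfl, hε₀pos.le⟩ x₀ a
      (a / 2) L K := by
    refine IsPicardLindelof.of_time_independent hb hf ?_
    have hL0' : (L : ℝ) ≠ 0 := by exact_mod_cast hL0.ne'
    simp only [sub_zero, sub_self]
    rw [max_eq_left hε₀pos.le, hε₀]
    push_cast
    field_simp
    norm_num
  obtain ⟨α, hα, L', hL'⟩ :=
    hPL.exists_forall_mem_closedBall_eq_hasDerivWithinAt_lipschitzOnWith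
  have hx₀mem : x₀ ∈ Metric.closedBall x₀ ((a / 2 : NNReal) : ℝ) :=
    Metric.mem_closedBall_self (NNReal.coe_nonneg _)
  obtain ⟨hα0, hαd⟩ := hα x₀ hx₀mem
  have hcont := (hαd 0 ⟨le_rfl, hε₀pos.le⟩).continuousWithinAt
  obtain ⟨η, hη, hηball⟩ := Metric.continuousWithinAt_iff.1 hcont (a / 2) (by positivity)
  set ε : ℝ := min (min ε₀ (η / 2)) (1 / (2 * (K * L' + 1))) with hε
  have hεpos : 0 < ε := by positivity
  have hεε₀ : ε ≤ ε₀ := (min_le_left _ _).trans (min_le_left _ _)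
  have hεη : ε < η := ((min_le_left _ _).trans (min_le_right _ _)).trans_lt (by linarith)
  have hεK : K * L' * ε ≤ 1 / 2 := by
    have h1 : ε ≤ 1 / (2 * (K * L' + 1)) := min_le_right _ _
    have h2 : (0 : ℝ) < K * L' + 1 := by positivity
    rw [le_div_iff₀ (by positivity)] at h1
    nlinarith
  have hsub : Set.Icc 0 ε ⊆ Set.Icc 0 ε₀ := Set.Icc_subset_Icc_right hεε₀
  set r : ℝ := min (a / 2) (a / (2 * (L' + 1))) with hr
  have hrpos : 0 < r := by positivity
  have hrL : L' * r ≤ a / 2 := by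
    have h1 : r ≤ a / (2 * (L' + 1)) := min_le_right _ _
    rw [le_div_iff₀ (by positivity)] at h1
    nlinarith
  have hball {x : E} (hx : x ∈ Metric.closedBall x₀ r) :
      x ∈ Metric.closedBall x₀ ((a / 2 : NNReal) : ℝ) :=
    Metric.closedBall_subset_closedBall (by push_cast; exact min_le_left _ _) hx
  have hstay (x : E) (hx : x ∈ Metric.closedBall x₀ r) (t : ℝ) (ht : t ∈ Set.Icc 0 ε) :
      α x t ∈ Metric.closedBall x₀ a := by
    have h₁ := (hL' t (hsub ht)).dist_le_mul x (hball hx) x₀ hx₀mem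
    have h₂ : dist (α x₀ t) (α x₀ 0) < a / 2 := hηball (hsub ht) (by
      rw [Real.dist_eq, sub_zero, abs_of_nonneg ht.1]; exact ht.2.trans_lt hεη)
    have h₃ : (L' : ℝ) * dist x x₀ ≤ L' * r := by gcongr; exact hx
    have hα0' : α x₀ 0 = x₀ := hα0
    rw [hα0'] at h₂
    have := dist_triangle (α x t) (α x₀ t) x₀
    rw [Metric.mem_closedBall]
    linarith
  refine ⟨r, hrpos, ε, hεpos, α, fun x hx ↦ ⟨(hα x (hball hx)).1, fun t ht ↦
    ⟨hstay x hx t ht, ((hα x (hball hx)).2 t (hsub ht)).mono hsub⟩⟩, fun x hx y hy ↦ ?_⟩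
  have hd (z : E) (hz : z ∈ Metric.closedBall x₀ r) (t : ℝ) (ht : t ∈ Set.Icc 0 ε) :
      HasDerivWithinAt (α z) (f (α z t)) (Set.Icc 0 ε) t :=
    ((hα z (hball hz)).2 t (hsub ht)).mono hsub
  have hx0 : α x 0 = x := (hα x (hball hx)).1
  have hy0 : α y 0 = y := (hα y (hball hy)).1
  have key := norm_image_sub_le_of_norm_deriv_le_segment' (f := fun t ↦ α x t - α y t)
    (C := K * (L' * ‖x - y‖)) (fun t ht ↦ (hd x hx t ht).sub (hd y hy t ht)) (fun t ht ↦ by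
      have ht' : t ∈ Set.Icc 0 ε := Set.Ico_subset_Icc_self ht
      refine (hf.norm_sub_le (hstay x hx t ht') (hstay y hy t ht')).trans ?_
      gcongr
      exact (hL' t (hsub ht')).norm_sub_le (hball hx) (hball hy)) ε ⟨hεpos.le, le_rfl⟩
  calc ‖(α x ε - x) - (α y ε - y)‖ = ‖α x ε - α y ε - (α x 0 - α y 0)‖ := by
        rw [hx0, hy0]; congr 1; abel
    _ ≤ K * (L' * ‖x - y‖) * (ε - 0) := key
    _ = K * L' * ε * ‖x - y‖ := by ring
    _ ≤ 1 / 2 * ‖x - y‖ := by gcongr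

/-- `f` is Lipschitz on some neighborhood of `x`. -/
def LipschitzNear {E F : Type*} [PseudoMetricSpace E] [PseudoMetricSpace F] (f : E → F) (x : E) :
    Prop :=
  ∃ K, ∃ s ∈ nhds x, LipschitzOnWith K f s

namespace LipschitzNear

variable {E F G : Type*} [NormedAddCommGroup E] [NormedAddCommGroup F] [NormedAddCommGroup G]
  {x : E}

lemma prodMk {f : E → F} {g : E → G} (hf : LipschitzNear f x) (hg : LipschitzNear g x) :
    LipschitzNear (fun z ↦ (f z, g z)) x := by
  obtain ⟨K, s, hs, hf⟩ := hf
  obtain ⟨K', s', hs', hg⟩ := hg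
  exact ⟨_, s ∩ s', inter_mem hs hs',
    (hf.mono Set.inter_subset_left).prodMk (hg.mono Set.inter_subset_right)⟩

lemma add {f g : E → F} (hf : LipschitzNear f x) (hg : LipschitzNear g x) :
    LipschitzNear (fun z ↦ f z + g z) x := by
  obtain ⟨K, s, hs, hf⟩ := hf
  obtain ⟨K', s', hs', hg⟩ := hg
  exact ⟨_, s ∩ s', inter_mem hs hs',
    (hf.mono Set.inter_subset_left).add (hg.mono Set.inter_subset_right)⟩

lemma mul {f g : E → ℂ} (hf : LipschitzNear f x) (hg : LipschitzNear g x) :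
    LipschitzNear (fun z ↦ f z * g z) x := by
  obtain ⟨K, s, hs, hf⟩ := hf
  obtain ⟨K', s', hs', hg⟩ := hg
  have hfb : ∀ᶠ z in nhds x, ‖f z‖ ≤ ‖f x‖ + 1 :=
    ((hf.continuousOn.continuousAt hs).norm.eventually_lt_const (lt_add_one _)).mono
      fun _ h ↦ h.le
  have hgb : ∀ᶠ z in nhds x, ‖g z‖ ≤ ‖g x‖ + 1 :=
    ((hg.continuousOn.continuousAt hs').norm.eventually_lt_const (lt_add_one _)).mono
      fun _ h ↦ h.le
  refine ⟨(‖f x‖₊ + 1) * K' + (‖g x‖₊ + 1) * K,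
    (s ∩ s') ∩ {z | ‖f z‖ ≤ ‖f x‖ + 1 ∧ ‖g z‖ ≤ ‖g x‖ + 1},
    inter_mem (inter_mem hs hs') (hfb.and hgb), ?_⟩
  rw [lipschitzOnWith_iff_norm_sub_le]
  rintro y ⟨⟨hy, hy'⟩, hyf, -⟩ z ⟨⟨hz, hz'⟩, -, hzg⟩
  calc ‖f y * g y - f z * g z‖ = ‖f y * (g y - g z) + (f y - f z) * g z‖ := by ring_nf
    _ ≤ (‖f x‖ + 1) * (K' * ‖y - z‖) + (K * ‖y - z‖) * (‖g x‖ + 1) := by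
      refine (norm_add_le _ _).trans (add_le_add ?_ ?_) <;> rw [norm_mul]
      · gcongr; exact hg.norm_sub_le hy' hz'
      · gcongr; exact hf.norm_sub_le hy hz
    _ = _ := by push_cast; ring

lemma comp_continuousLinearMap [NormedSpace ℝ E] [NormedSpace ℝ F] {f : F → G} {A : E →L[ℝ] F}
    (hf : LipschitzNear f (A x)) : LipschitzNear (fun z ↦ f (A z)) x := by
  obtain ⟨K, s, hs, hf⟩ := hf
  exact ⟨_, A ⁻¹' s, A.continuous.continuousAt hs,
    hf.comp A.lipschitz.lipschitzOnWith (Set.mapsTo_preimage _ _)⟩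

end LipschitzNear

lemma ContDiffAt.lipschitzNear {E F : Type*} [NormedAddCommGroup E] [NormedSpace ℝ E]
    [NormedAddCommGroup F] [NormedSpace ℝ F] {f : E → F} {x : E} (hf : ContDiffAt ℝ 1 f x) :
    LipschitzNear f x :=
  hf.exists_lipschitzOnWith

namespace W10

/-- The determinant of the linear forms `(4 A + 2 σ B, (3 σ + t y) A + 6 B)` in `A = x ^ 2`,
`B = y ^ 3`, where `σ = s + t y`. -/
noncomputable def det (s t y : ℂ) : ℂ := 24 - 2 * (s + t * y) * (3 * (s + t * y) + t * y)

/-- First component of the trivializing vector field. -/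
noncomputable def fieldX (s t : ℂ) (p : ℂ × ℂ) : ℂ :=
  -6 * (det s t p.2)⁻¹ * gaugeQuotient 1 2 4 0 p +
    (3 * (s + t * p.2) + t * p.2) * (det s t p.2)⁻¹ * gaugeQuotient 1 0 4 3 p

/-- Second component of the trivializing vector field. -/
noncomputable def fieldY (s t : ℂ) (p : ℂ × ℂ) : ℂ :=
  2 * (s + t * p.2) * (det s t p.2)⁻¹ * gaugeQuotient 2 2 2 0 p +
    -4 * (det s t p.2)⁻¹ * gaugeQuotient 2 0 2 3 p

lemma field_eq {s t x y : ℂ} (h : det s t y ≠ 0) :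
    x ^ 2 * y ^ 4 + (4 * x ^ 3 + 2 * s * x * y ^ 3 + 2 * t * x * y ^ 4) * fieldX s t (x, y) +
      (3 * s * x ^ 2 * y ^ 2 + 4 * t * x ^ 2 * y ^ 3 + 6 * y ^ 5) * fieldY s t (x, y) = 0 := by
  by_cases h0 : x = 0 ∧ y = 0
  · simp [h0.1, h0.2]
  have hN : ‖x‖ ^ 4 + ‖y‖ ^ 6 ≠ 0 := by
    intro hN
    have hx : 0 ≤ ‖x‖ ^ 4 := by positivity
    have hy : 0 ≤ ‖y‖ ^ 6 := by positivity
    exact h0 ⟨by simpa using (show ‖x‖ ^ 4 = 0 by linarith),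
      by simpa using (show ‖y‖ ^ 6 = 0 by linarith)⟩
  have hNc : ((‖x‖ ^ 4 + ‖y‖ ^ 6 : ℝ) : ℂ) =
      x ^ 2 * starRingEnd ℂ x ^ 2 + y ^ 3 * starRingEnd ℂ y ^ 3 := by
    rw [← mul_pow, ← mul_pow, Complex.mul_conj', Complex.mul_conj']
    push_cast
    ring
  have hN' : x ^ 2 * starRingEnd ℂ x ^ 2 + y ^ 3 * starRingEnd ℂ y ^ 3 ≠ 0 := by
    rw [← hNc]; exact_mod_cast hN
  simp only [fieldX, fieldY, gaugeQuotient, hNc]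
  generalize starRingEnd ℂ x = X at *
  generalize starRingEnd ℂ y = Y at *
  generalize hD : det s t y = D at *
  field_simp
  rw [← hD, det]
  ring

lemma fieldX_zero (s t : ℂ) : fieldX s t 0 = 0 := by simp [fieldX, gaugeQuotient]

lemma fieldY_zero (s t : ℂ) : fieldY s t 0 = 0 := by simp [fieldY, gaugeQuotient]

/-- The autonomous vector field on the states `(c, t, x, y)`: the parameter `t` moves with constant
velocity `c` and the point `(x, y)` is transported so that the function value is preserved. -/
noncomputable def field (s : ℂ) (z : ℂ × ℂ × ℂ × ℂ) : ℂ × ℂ × ℂ × ℂ :=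
  (0, z.1, z.1 * fieldX s z.2.1 z.2.2, z.1 * fieldY s z.2.1 z.2.2)

lemma det_zero_ne_zero {s : ℂ} (hs : s ^ 2 ≠ 4) (t : ℂ) : det s t 0 ≠ 0 := by
  intro h
  apply hs
  unfold det at h
  linear_combination (-1 / 6) * h

lemma field_lipschitzNear {s : ℂ} (hs : s ^ 2 ≠ 4) (t₀ : ℂ) :
    LipschitzNear (field s) (0, t₀, 0) := by
  have hd : det s t₀ 0 ≠ 0 := det_zero_ne_zero hs t₀
  have hg {i j k l : ℕ}
      (h : ∃ K, LipschitzOnWith K (gaugeQuotient i j k l) (Metric.closedBall 0 1)) :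
      LipschitzNear (fun z : ℂ × ℂ × ℂ × ℂ ↦ gaugeQuotient i j k l z.2.2) (0, t₀, 0) := by
    obtain ⟨K, hK⟩ := h
    exact LipschitzNear.comp_continuousLinearMap
      (A := (ContinuousLinearMap.snd ℝ ℂ (ℂ × ℂ)).comp (ContinuousLinearMap.snd ℝ ℂ (ℂ × ℂ × ℂ)))
      ⟨K, _, Metric.closedBall_mem_nhds 0 one_pos, hK⟩
  have h₁ := hg (gaugeQuotient_lipschitzOnWith (i := 1) (j := 2) (k := 4) (l := 0) (p := 1) (q := 1)
    (by norm_num) (by norm_num) (by norm_num) (by norm_num) (by norm_num) (by norm_num)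
    (by norm_num))
  have h₂ := hg (gaugeQuotient_lipschitzOnWith (i := 1) (j := 0) (k := 4) (l := 3) (p := 1) (q := 1)
    (by norm_num) (by norm_num) (by norm_num) (by norm_num) (by norm_num) (by norm_num)
    (by norm_num))
  have h₃ := hg (gaugeQuotient_lipschitzOnWith (i := 2) (j := 2) (k := 2) (l := 0) (p := 0) (q := 2)
    (by norm_num) (by norm_num) (by norm_num) (by norm_num) (by norm_num) (by norm_num)
    (by norm_num))
  have h₄ := hg (gaugeQuotient_lipschitzOnWith (i := 2) (j := 0) (k := 2) (l := 3) (p := 0) (q := 2)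
    (by norm_num) (by norm_num) (by norm_num) (by norm_num) (by norm_num) (by norm_num)
    (by norm_num))
  have hdet : ContDiffAt ℝ 1 (fun z : ℂ × ℂ × ℂ × ℂ ↦ (det s z.2.1 z.2.2.2)⁻¹) (0, t₀, 0) := by
    refine ContDiffAt.inv ?_ hd
    unfold det
    fun_prop
  have hc : LipschitzNear (fun z : ℂ × ℂ × ℂ × ℂ ↦ z.1) (0, t₀, 0) :=
    ContDiffAt.lipschitzNear (by fun_prop)
  have hzero : LipschitzNear (fun _ : ℂ × ℂ × ℂ × ℂ ↦ (0 : ℂ)) (0, t₀, 0) :=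
    ContDiffAt.lipschitzNear (by fun_prop)
  refine hzero.prodMk (hc.prodMk ((hc.mul (.add (.mul ?_ h₁) (.mul ?_ h₂))).prodMk
    (hc.mul (.add (.mul ?_ h₃) (.mul ?_ h₄))))) <;>
  exact ContDiffAt.lipschitzNear (ContDiffAt.mul (by fun_prop) hdet)

/-- The family of functions, as a function of the parameter and the two coordinates. -/
def family (s t x y : ℂ) : ℂ := x ^ 4 + s * x ^ 2 * y ^ 3 + t * x ^ 2 * y ^ 4 + y ^ 6

lemma hasDerivWithinAt_components {s : ℂ} {γ : ℝ → ℂ × ℂ × ℂ × ℂ} {S : Set ℝ} {τ : ℝ}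
    (h : HasDerivWithinAt γ (field s (γ τ)) S τ) :
    HasDerivWithinAt (fun τ ↦ (γ τ).1) 0 S τ ∧
    HasDerivWithinAt (fun τ ↦ (γ τ).2.1) (γ τ).1 S τ ∧
    HasDerivWithinAt (fun τ ↦ (γ τ).2.2.1) ((γ τ).1 * fieldX s (γ τ).2.1 (γ τ).2.2) S τ ∧
    HasDerivWithinAt (fun τ ↦ (γ τ).2.2.2) ((γ τ).1 * fieldY s (γ τ).2.1 (γ τ).2.2) S τ := by
  have h' := h.hasFDerivWithinAt
  exact ⟨by simpa [field] using h'.fst.hasDerivWithinAt,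
    by simpa [field] using h'.snd.fst.hasDerivWithinAt,
    by simpa [field] using h'.snd.snd.fst.hasDerivWithinAt,
    by simpa [field] using h'.snd.snd.snd.hasDerivWithinAt⟩

/-- The function value is constant along integral curves of `field`. -/
lemma family_integralCurve {s : ℂ} {ε : ℝ} {γ : ℝ → ℂ × ℂ × ℂ × ℂ}
    (hγ : ∀ τ ∈ Set.Icc 0 ε, HasDerivWithinAt γ (field s (γ τ)) (Set.Icc 0 ε) τ)
    (hdet : ∀ τ ∈ Set.Icc 0 ε, det s (γ τ).2.1 (γ τ).2.2.2 ≠ 0) {τ : ℝ} (hτ : τ ∈ Set.Icc 0 ε) :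
    family s (γ τ).2.1 (γ τ).2.2.1 (γ τ).2.2.2 = family s (γ 0).2.1 (γ 0).2.2.1 (γ 0).2.2.2 := by
  have hd (τ : ℝ) (hτ : τ ∈ Set.Icc 0 ε) : HasDerivWithinAt
      (fun τ ↦ family s (γ τ).2.1 (γ τ).2.2.1 (γ τ).2.2.2) 0 (Set.Icc 0 ε) τ := by
    obtain ⟨-, ht, hx, hy⟩ := hasDerivWithinAt_components (hγ τ hτ)
    have key := field_eq (x := (γ τ).2.2.1) (hdet τ hτ)
    have h : HasDerivWithinAt (fun τ ↦ family s (γ τ).2.1 (γ τ).2.2.1 (γ τ).2.2.2) _ _ _ :=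
      (((hx.pow 4).add (((hx.pow 2).const_mul s).mul (hy.pow 3))).add
        ((ht.mul (hx.pow 2)).mul (hy.pow 4))).add (hy.pow 6)
    refine h.congr_deriv ?_
    simp only [Pi.pow_apply, Pi.mul_apply, Prod.mk.eta] at key ⊢
    push_cast
    linear_combination (γ τ).1 * key
  have := norm_image_sub_le_of_norm_deriv_le_segment' hd (fun _ _ ↦ norm_zero.le) τ hτ
  simpa [sub_eq_zero] using this

lemma integralCurve_fst {s : ℂ} {ε : ℝ} {γ : ℝ → ℂ × ℂ × ℂ × ℂ}
    (hγ : ∀ τ ∈ Set.Icc 0 ε, HasDerivWithinAt γ (field s (γ τ)) (Set.Icc 0 ε) τ)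
    {τ : ℝ} (hτ : τ ∈ Set.Icc 0 ε) : (γ τ).1 = (γ 0).1 := by
  have := norm_image_sub_le_of_norm_deriv_le_segment'
    (fun τ hτ ↦ (hasDerivWithinAt_components (hγ τ hτ)).1) (fun _ _ ↦ norm_zero.le) τ hτ
  simpa [sub_eq_zero] using this

lemma integralCurve_snd {s : ℂ} {ε : ℝ} {γ : ℝ → ℂ × ℂ × ℂ × ℂ}
    (hγ : ∀ τ ∈ Set.Icc 0 ε, HasDerivWithinAt γ (field s (γ τ)) (Set.Icc 0 ε) τ)
    {τ : ℝ} (hτ : τ ∈ Set.Icc 0 ε) : (γ τ).2.1 = (γ 0).2.1 + τ * (γ 0).1 := by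
  have hd (τ : ℝ) (hτ : τ ∈ Set.Icc 0 ε) :
      HasDerivWithinAt (fun τ : ℝ ↦ (γ τ).2.1 - τ * (γ 0).1) 0 (Set.Icc 0 ε) τ := by
    refine ((hasDerivWithinAt_components (hγ τ hτ)).2.1.sub
      ((Complex.ofRealCLM.hasDerivWithinAt (x := τ)).mul_const (γ 0).1)).congr_deriv ?_
    simp [integralCurve_fst hγ hτ]
  have := norm_image_sub_le_of_norm_deriv_le_segment' hd (fun _ _ ↦ norm_zero.le) τ hτ
  simp only [Complex.ofReal_zero, zero_mul, sub_zero, norm_le_zero_iff] at this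
  linear_combination this

/-- Integral curves starting on `x = y = 0` stay there. -/
lemma integralCurve_eq_zero {s t₀ : ℂ} {a ε : ℝ} {K : NNReal} {γ : ℝ → ℂ × ℂ × ℂ × ℂ}
    (hK : LipschitzOnWith K (field s) (Metric.closedBall (0, t₀, 0) a))
    (hγ : ∀ τ ∈ Set.Icc 0 ε, γ τ ∈ Metric.closedBall (0, t₀, 0) a ∧
      HasDerivWithinAt γ (field s (γ τ)) (Set.Icc 0 ε) τ)
    (h0 : (γ 0).2.2 = 0) {τ : ℝ} (hτ : τ ∈ Set.Icc 0 ε) : (γ τ).2.2 = 0 := by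
  have hγ' := fun τ hτ ↦ (hγ τ hτ).2
  have hIci {g : ℝ → ℂ × ℂ × ℂ × ℂ} {g' : ℂ × ℂ × ℂ × ℂ} {τ : ℝ} (hτ : τ ∈ Set.Ico 0 ε)
      (h : HasDerivWithinAt g g' (Set.Icc 0 ε) τ) : HasDerivWithinAt g g' (Set.Ici τ) τ :=
    h.mono_of_mem_nhdsWithin (Icc_mem_nhdsGE_of_mem hτ)
  have hg (τ : ℝ) : HasDerivAt
      (fun τ : ℝ ↦ (((γ 0).1, (γ 0).2.1 + τ * (γ 0).1, 0) : ℂ × ℂ × ℂ × ℂ))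
      (field s ((γ 0).1, (γ 0).2.1 + τ * (γ 0).1, 0)) τ := by
    refine ((hasDerivAt_const τ (γ 0).1).prodMk
      ((((Complex.ofRealCLM.hasDerivAt (x := τ)).mul_const (γ 0).1).const_add (γ 0).2.1).prodMk
        (hasDerivAt_const τ (0 : ℂ × ℂ)))).congr_deriv ?_
    ext <;> simp [field, fieldX_zero, fieldY_zero]
  have := ODE_solution_unique_of_mem_Icc_right (v := fun _ ↦ field s)
    (s := fun _ ↦ Metric.closedBall (0, t₀, 0) a) (fun _ _ ↦ hK)
    (HasDerivWithinAt.continuousOn hγ') (fun τ hτ ↦ hIci hτ (hγ' τ (Set.Ico_subset_Icc_self hτ)))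
    (fun τ hτ ↦ (hγ τ (Set.Ico_subset_Icc_self hτ)).1)
    (fun τ _ ↦ (hg τ).continuousAt.continuousWithinAt) (fun τ _ ↦ (hg τ).hasDerivWithinAt)
    (fun τ hτ ↦ ?_) (by ext <;> simp [h0]) hτ
  · rw [this]
  · have hτ' := Set.Ico_subset_Icc_self hτ
    have hm := (hγ τ hτ').1
    simp only [Metric.mem_closedBall, Prod.dist_eq, max_le_iff] at hm ⊢
    rw [← integralCurve_snd hγ' hτ', ← integralCurve_fst hγ' hτ']
    exact ⟨hm.1, hm.2.1, by simpa using dist_nonneg.trans hm.1⟩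

/-- A map which differs from the identity by a `1 / 2`-Lipschitz map is open. -/
lemma image_ball_mem_nhds {g : ℂ × ℂ → ℂ × ℂ} {r : ℝ} (hr : 0 < r) (h0 : g 0 = 0)
    (hg : ∀ p ∈ Metric.ball (0 : ℂ × ℂ) r, ∀ q ∈ Metric.ball (0 : ℂ × ℂ) r,
      ‖(g p - p) - (g q - q)‖ ≤ 1 / 2 * ‖p - q‖) :
    g '' Metric.ball 0 r ∈ nhds 0 := by
  have happ : ApproximatesLinearOn g
      (ContinuousLinearEquiv.refl ℝ (ℂ × ℂ) : (ℂ × ℂ) →L[ℝ] ℂ × ℂ) (Metric.ball 0 r) (1 / 2) := by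
    intro p hp q hq
    have h : g p - g q - (p - q) = (g p - p) - (g q - q) := by abel
    simpa [h] using hg p hp q hq
  have := happ.image_mem_nhds (x := 0)
    (ContinuousLinearEquiv.refl ℝ (ℂ × ℂ)).toNonlinearRightInverse
    (Metric.ball_mem_nhds 0 hr) (Or.inr ?_)
  · rwa [h0] at this
  · have h1 : (ContinuousLinearEquiv.refl ℝ (ℂ × ℂ)).toNonlinearRightInverse.nnnorm = 1 := by
      simp [ContinuousLinearEquiv.toNonlinearRightInverse]
    rw [h1, inv_one]
    exact NNReal.half_lt_self one_ne_zero

end W10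

/-- The family W10, `F t = fun (x,y) => w.1 ^ 4 + s * w.1 ^ 2 * w.2 ^ 3 + τ * w.1 ^ 2 * w.2 ^ 4 + w.2 ^ 6`, is Lipschitz trivial in `t` over `ℂ`:
for every `t₀` there are a neighborhood `T` of `t₀`, `r > 0`, `L ≥ 1`, and a
continuous family `H` of bi-Lipschitz homeomorphisms with `F t ∘ H t = F t₀` on
`B(0,r)`. -/
theorem lipschitz_trivial_W10 (s : ℂ) (hs : s ^ 2 ≠ 4) (t₀ : ℂ) :
    ∃ T ∈ nhds t₀, ∃ r L : ℝ, 0 < r ∧ 1 ≤ L ∧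
      ∃ H : ℂ × (ℂ × ℂ) → ℂ × ℂ,
        ContinuousOn H (T ×ˢ Metric.ball (0 : ℂ × ℂ) r) ∧
        ∀ t ∈ T,
          H (t, 0) = 0 ∧
          (∀ p ∈ Metric.ball (0 : ℂ × ℂ) r, ∀ q ∈ Metric.ball (0 : ℂ × ℂ) r,
            L⁻¹ * ‖p - q‖ ≤ ‖H (t, p) - H (t, q)‖ ∧
            ‖H (t, p) - H (t, q)‖ ≤ L * ‖p - q‖) ∧
          ((fun p => H (t, p)) '' Metric.ball (0 : ℂ × ℂ) r ∈ nhds (0 : ℂ × ℂ)) ∧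
          ∀ p ∈ Metric.ball (0 : ℂ × ℂ) r,
            (fun (τ : ℂ) (w : ℂ × ℂ) => w.1 ^ 4 + s * w.1 ^ 2 * w.2 ^ 3 + τ * w.1 ^ 2 * w.2 ^ 4 + w.2 ^ 6) t (H (t, p)) =
            (fun (τ : ℂ) (w : ℂ × ℂ) => w.1 ^ 4 + s * w.1 ^ 2 * w.2 ^ 3 + τ * w.1 ^ 2 * w.2 ^ 4 + w.2 ^ 6) t₀ p := by
  obtain ⟨K, S, hS, hK⟩ := W10.field_lipschitzNear hs t₀
  have hdet : ∀ᶠ z : ℂ × ℂ × ℂ × ℂ in nhds (0, t₀, 0), W10.det s z.2.1 z.2.2.2 ≠ 0 := by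
    have hc : Continuous fun z : ℂ × ℂ × ℂ × ℂ ↦ W10.det s z.2.1 z.2.2.2 := by
      unfold W10.det; fun_prop
    exact hc.continuousAt.eventually_ne (W10.det_zero_ne_zero hs t₀)
  obtain ⟨a, ha, haS⟩ := Metric.nhds_basis_closedBall.mem_iff.1 (inter_mem hS hdet)
  replace hK := hK.mono (haS.trans Set.inter_subset_left)
  obtain ⟨r, hr, ε, hε, α, hα, hLip⟩ := exists_local_flow_of_lipschitzOnWith ha hK
  have hεmem : ε ∈ Set.Icc 0 ε := ⟨hε.le, le_rfl⟩
  have hz {t : ℂ} {p : ℂ × ℂ} (ht : t ∈ Metric.ball t₀ (r * ε)) (hp : p ∈ Metric.ball 0 r) :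
      ((t - t₀) / ε, t₀, p) ∈ Metric.closedBall ((0, t₀, 0) : ℂ × ℂ × ℂ × ℂ) r := by
    rw [Metric.mem_ball, dist_eq_norm] at ht
    have hp' : dist p 0 ≤ r := (Metric.mem_ball.1 hp).le
    rw [Metric.mem_closedBall, Prod.dist_eq, Prod.dist_eq]
    refine max_le ?_ (max_le (by simpa using hr.le) hp')
    rw [dist_zero_right, norm_div, Complex.norm_real, Real.norm_of_nonneg hε.le, div_le_iff₀ hε]
    exact ht.le
  have hdiff (t : ℂ) (ht : t ∈ Metric.ball t₀ (r * ε)) (p : ℂ × ℂ) (hp : p ∈ Metric.ball 0 r)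
      (q : ℂ × ℂ) (hq : q ∈ Metric.ball 0 r) :
      ‖((α ((t - t₀) / ε, t₀, p) ε).2.2 - p) - ((α ((t - t₀) / ε, t₀, q) ε).2.2 - q)‖ ≤
        1 / 2 * ‖p - q‖ := by
    have h := hLip _ (hz ht hp) _ (hz ht hq)
    have hpq : ‖(((t - t₀) / ε, t₀, p) : ℂ × ℂ × ℂ × ℂ) - ((t - t₀) / ε, t₀, q)‖ = ‖p - q‖ := by
      simp [Prod.norm_def]
    rw [hpq] at h
    exact ((norm_snd_le _).trans (norm_snd_le _)).trans h
  refine ⟨Metric.ball t₀ (r * ε), Metric.ball_mem_nhds _ (by positivity), r, 2, hr, one_le_two,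
    fun w ↦ (α ((w.1 - t₀) / ε, t₀, w.2) ε).2.2, ?_, fun t ht ↦ ?_⟩
  · have hα_cont : ContinuousOn (fun z ↦ α z ε) (Metric.closedBall (0, t₀, 0) r) := by
      have h₁ : LipschitzOnWith (1 / 2) (fun z ↦ α z ε - z) (Metric.closedBall (0, t₀, 0) r) := by
        rw [lipschitzOnWith_iff_norm_sub_le]
        simpa using hLip
      exact (h₁.continuousOn.add continuousOn_id).congr fun z _ ↦ by simp
    refine continuous_snd.comp_continuousOn (continuous_snd.comp_continuousOn
      (hα_cont.comp (f := fun w : ℂ × ℂ × ℂ ↦ ((w.1 - t₀) / ε, t₀, w.2)) ?_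
        fun w hw ↦ hz hw.1 hw.2))
    exact Continuous.continuousOn (by fun_prop)
  · have hzero : (α ((t - t₀) / ε, t₀, 0) ε).2.2 = 0 := by
      have hz0 := hα _ (hz ht (Metric.mem_ball_self hr))
      exact W10.integralCurve_eq_zero hK hz0.2 (by rw [hz0.1]) hεmem
    refine ⟨hzero, fun p hp q hq ↦ ?_,
      W10.image_ball_mem_nhds hr hzero (hdiff t ht), fun p hp ↦ ?_⟩
    · have h := hdiff t ht p hp q hq
      set P := (α ((t - t₀) / ε, t₀, p) ε).2.2
      set Q := (α ((t - t₀) / ε, t₀, q) ε).2.2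
      have e : P - p - (Q - q) = (P - Q) - (p - q) := by abel
      rw [e] at h
      have h₁ := norm_le_norm_add_norm_sub' (p - q) (P - Q)
      have h₂ := norm_le_norm_add_norm_sub' (P - Q) (p - q)
      rw [norm_sub_rev (p - q) (P - Q)] at h₁
      change 2⁻¹ * ‖p - q‖ ≤ ‖P - Q‖ ∧ ‖P - Q‖ ≤ 2 * ‖p - q‖
      constructor <;> linarith [norm_nonneg (p - q)]
    · obtain ⟨h0, hγ⟩ := hα _ (hz ht hp)
      have hγ' := fun τ hτ ↦ (hγ τ hτ).2
      have hF := W10.family_integralCurve hγ' (fun τ hτ ↦ (haS (hγ τ hτ).1).2) hεmem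
      have ht' := W10.integralCurve_snd hγ' hεmem
      have hε' : (ε : ℂ) ≠ 0 := by exact_mod_cast hε.ne'
      rw [ht', h0, mul_div_cancel₀ _ hε', add_sub_cancel] at hF
      exact hF
end

section
/- Fix an integer q ≥ 1 and s ∈ ℂ with s ≠ 0, and define F : ℂ × ℂ² → ℂ by F(t,(x,y)) = (x² + y³)² + s x y^{4+q} + t x y^{5+q} (the family W^{#}_{1,2q−1}). Then F is Lipschitz trivial in t over ℂ: for every t₀ ∈ ℂ there exist a neighborhood T of t₀ in ℂ, a radius r > 0, a constant L ≥ 1, and a continuous map H : T × B(0,r) → ℂ² such that for each t ∈ T: H(t,0) = 0; L⁻¹‖p − q'‖ ≤ ‖H(t,p) − H(t,q')‖ ≤ L‖p − q'‖ for all p, q' ∈ B(0,r); the image H(t, B(0,r)) is a neighborhood of 0 in ℂ²; and F(t, H(t,p)) = F(t₀, p) for all p ∈ B(0,r). -/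
open Filter

section Flow

open Set Metric
open scoped NNReal

variable {Z : Type*} [NormedAddCommGroup Z] [NormedSpace ℝ Z]

/-- Two integral curves of a `K`-Lipschitz field stay within a factor `2` of their initial distance
up to the time `(2 * K)⁻¹`. -/
lemma dist_le_two_mul_of_isIntegralCurveOn {W : Z → Z} {K : ℝ≥0} (hK : 0 < K)
    (hW : LipschitzWith K W) {γ₁ γ₂ : ℝ → Z}
    (h₁ : IsIntegralCurveOn γ₁ (fun _ => W) (Icc 0 (2 * (K : ℝ))⁻¹))
    (h₂ : IsIntegralCurveOn γ₂ (fun _ => W) (Icc 0 (2 * (K : ℝ))⁻¹))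
    {τ : ℝ} (hτ : τ ∈ Icc 0 (2 * (K : ℝ))⁻¹) :
    dist (γ₁ τ) (γ₂ τ) ≤ 2 * dist (γ₁ 0) (γ₂ 0) := by
  have right {γ : ℝ → Z} (h : IsIntegralCurveOn γ (fun _ => W) (Icc 0 (2 * (K : ℝ))⁻¹)) :
      ∀ t ∈ Ico 0 (2 * (K : ℝ))⁻¹, HasDerivWithinAt γ (W (γ t)) (Ici t) t := fun t ht =>
    (h t (Ico_subset_Icc_self ht)).mono_of_mem_nhdsWithin (Icc_mem_nhdsGE_of_mem ht)
  have h := dist_le_of_trajectories_ODE (v := fun _ => W) (fun _ => hW) h₁.continuousOn (right h₁)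
    h₂.continuousOn (right h₂) le_rfl τ hτ
  have hK' : (0 : ℝ) < K := hK
  have hexp : Real.exp (K * (τ - 0)) ≤ 2 := by
    have : (K : ℝ) * (τ - 0) ≤ 1 / 2 := by
      calc (K : ℝ) * (τ - 0) ≤ K * (2 * (K : ℝ))⁻¹ := by rw [sub_zero]; gcongr; exact hτ.2
        _ = 1 / 2 := by field_simp
    calc Real.exp (K * (τ - 0)) ≤ Real.exp (1 / 2) := Real.exp_le_exp.2 this
      _ ≤ 2 := by
        have h1 := Real.exp_one_lt_d9
        have h2 : Real.exp (1 / 2) * Real.exp (1 / 2) = Real.exp 1 := by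
          rw [← Real.exp_add]; norm_num
        nlinarith [Real.exp_pos (1 / 2)]
  calc dist (γ₁ τ) (γ₂ τ) ≤ dist (γ₁ 0) (γ₂ 0) * Real.exp (K * (τ - 0)) := h
    _ ≤ dist (γ₁ 0) (γ₂ 0) * 2 := by gcongr
    _ = 2 * dist (γ₁ 0) (γ₂ 0) := mul_comm _ _

/-- A globally Lipschitz field with a zero has integral curves through every point, up to a time
depending only on the Lipschitz constant. -/
lemma exists_isIntegralCurveOn_of_lipschitzWith [CompleteSpace Z] {W : Z → Z} {K : ℝ≥0}
    (hK : 0 < K) (hW : LipschitzWith K W) {z₀ : Z} (hz₀ : W z₀ = 0) (z : Z) :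
    ∃ γ : ℝ → Z, γ 0 = z ∧ IsIntegralCurveOn γ (fun _ => W) (Icc 0 (2 * (K : ℝ))⁻¹) := by
  have hK' : (0 : ℝ) < K := hK
  set r : ℝ≥0 := nndist z z₀
  have hε : (0 : ℝ) ≤ (2 * (K : ℝ))⁻¹ := by positivity
  have hpl : IsPicardLindelof (fun _ => W) (⟨0, le_rfl, hε⟩ : Icc (0 : ℝ) (2 * (K : ℝ))⁻¹) z₀
      (2 * r) r (K * (2 * r)) K := by
    refine IsPicardLindelof.of_time_independent (fun x hx => ?_) hW.lipschitzOnWith ?_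
    · have := hW.dist_le_mul x z₀
      rw [hz₀, dist_zero_right] at this
      refine this.trans ?_
      push_cast
      gcongr
      simpa using hx
    · have : max ((2 * (K : ℝ))⁻¹ - 0) (0 - 0) = (2 * (K : ℝ))⁻¹ := by simp
      simp only [this]
      push_cast
      refine le_of_eq ?_
      field_simp
      ring
  obtain ⟨γ, h0, hγ⟩ := hpl.exists_eq_forall_mem_Icc_hasDerivWithinAt (x := z)
    (by simp [r])
  exact ⟨γ, h0, hγ⟩

lemma IsIntegralCurveOn.comp_const_sub {W : Z → Z} {ε : ℝ} {γ : ℝ → Z}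
    (h : IsIntegralCurveOn γ (fun _ => W) (Icc 0 ε)) :
    IsIntegralCurveOn (fun τ => γ (ε - τ)) (fun _ => -W) (Icc 0 ε) := by
  intro τ hτ
  have hm : MapsTo (fun τ : ℝ => ε - τ) (Icc 0 ε) (Icc 0 ε) := fun x hx =>
    ⟨by linarith [hx.2], by linarith [hx.1]⟩
  have h1 : HasDerivWithinAt (fun τ : ℝ => ε - τ) (-1) (Icc 0 ε) τ :=
    ((hasDerivAt_id τ).const_sub ε).hasDerivWithinAt
  have := (h _ (hm hτ)).scomp τ h1 hm
  simpa [Function.comp_def] using this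

/-- The time-`ε` flow of a globally Lipschitz field with a zero is a bi-Lipschitz bijection. -/
lemma exists_flow_of_lipschitzWith [CompleteSpace Z] {W : Z → Z} {K : ℝ≥0}
    (hK : 0 < K) (hW : LipschitzWith K W) {z₀ : Z} (hz₀ : W z₀ = 0) :
    ∃ ε > (0 : ℝ), ∃ Φ : Z ≃ Z, LipschitzWith 2 Φ ∧ LipschitzWith 2 Φ.symm ∧
      (∀ γ : ℝ → Z, IsIntegralCurveOn γ (fun _ => W) (Icc 0 ε) → Φ (γ 0) = γ ε) ∧
      ∀ z, ∃ γ : ℝ → Z, γ 0 = z ∧ IsIntegralCurveOn γ (fun _ => W) (Icc 0 ε) ∧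
        ∀ τ ∈ Icc 0 ε, dist (γ τ) z₀ ≤ 2 * dist z z₀ := by
  have hK' : (0 : ℝ) < K := hK
  have hε : (0 : ℝ) < (2 * (K : ℝ))⁻¹ := by positivity
  have hmem : (2 * (K : ℝ))⁻¹ ∈ Icc (0 : ℝ) (2 * (K : ℝ))⁻¹ := ⟨hε.le, le_rfl⟩
  have hW' : LipschitzWith K (-W) := hW.neg
  choose α hα0 hα using exists_isIntegralCurveOn_of_lipschitzWith hK hW hz₀
  choose β hβ0 hβ using exists_isIntegralCurveOn_of_lipschitzWith hK hW' (z₀ := z₀) (by simp [hz₀])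
  have unique {U : Z → Z} (hU : LipschitzWith K U) {γ₁ γ₂ : ℝ → Z}
      (h₁ : IsIntegralCurveOn γ₁ (fun _ => U) (Icc 0 (2 * (K : ℝ))⁻¹))
      (h₂ : IsIntegralCurveOn γ₂ (fun _ => U) (Icc 0 (2 * (K : ℝ))⁻¹)) (h : γ₁ 0 = γ₂ 0) :
      γ₁ (2 * (K : ℝ))⁻¹ = γ₂ (2 * (K : ℝ))⁻¹ := by
    have := dist_le_two_mul_of_isIntegralCurveOn hK hU h₁ h₂ hmem
    rw [h, dist_self, mul_zero] at this
    exact dist_le_zero.1 this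
  refine ⟨(2 * (K : ℝ))⁻¹, hε,
    { toFun := fun z => α z (2 * (K : ℝ))⁻¹
      invFun := fun z => β z (2 * (K : ℝ))⁻¹
      left_inv := fun z => ?_
      right_inv := fun z => ?_ }, ?_, ?_, fun γ hγ => ?_, fun z => ⟨α z, hα0 z, hα z, ?_⟩⟩
  · have := unique hW' (hβ (α z (2 * (K : ℝ))⁻¹)) (hα z).comp_const_sub (by simp [hβ0])
    simpa [hα0] using this
  · have h := (hβ z).comp_const_sub
    rw [neg_neg] at h
    have := unique hW (hα (β z (2 * (K : ℝ))⁻¹)) h (by simp [hα0])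
    simpa [hβ0] using this
  · refine LipschitzWith.of_dist_le_mul fun z z' => ?_
    simpa [hα0] using dist_le_two_mul_of_isIntegralCurveOn hK hW (hα z) (hα z') hmem
  · refine LipschitzWith.of_dist_le_mul fun z z' => ?_
    simpa [hβ0] using dist_le_two_mul_of_isIntegralCurveOn hK hW' (hβ z) (hβ z') hmem
  · exact unique hW (hα (γ 0)) hγ (hα0 _)
  · intro τ hτ
    have hc : IsIntegralCurveOn (fun _ => z₀) (fun _ => W) (Icc 0 (2 * (K : ℝ))⁻¹) := fun t _ => by
      simpa [hz₀] using hasDerivWithinAt_const t _ z₀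
    simpa [hα0] using dist_le_two_mul_of_isIntegralCurveOn hK hW (hα z) hc hτ

end Flow

section Trivialization

open Set Metric
open scoped NNReal

/-- **Integration of a Lipschitz vector field.** If `V` is a Lipschitz field of `ℂ × ℂ` depending on
a parameter `t`, vanishing at the origin and such that `∂/∂t + V` annihilates `F`, then the flow of
`∂/∂t + V` provides a continuous family of bi-Lipschitz germs trivializing `F`. -/
lemma exists_lipschitz_trivialization (F : ℂ × (ℂ × ℂ) → ℂ) (V : ℂ × (ℂ × ℂ) → ℂ × ℂ) (t₀ : ℂ)
    {K : ℝ≥0} {δ : ℝ} (hδ : 0 < δ) (hV : LipschitzOnWith K V (ball (t₀, 0) δ))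
    (hV0 : ∀ t, V (t, 0) = 0)
    (hF : ∀ z ∈ ball (t₀, (0 : ℂ × ℂ)) δ, ∃ F' : ℂ × (ℂ × ℂ) →L[ℂ] ℂ,
      HasFDerivAt F F' z ∧ F' (1, V z) = 0) :
    ∃ T ∈ nhds t₀, ∃ r L : ℝ, 0 < r ∧ 1 ≤ L ∧
      ∃ H : ℂ × (ℂ × ℂ) → ℂ × ℂ,
        ContinuousOn H (T ×ˢ ball (0 : ℂ × ℂ) r) ∧
        ∀ t ∈ T,
          H (t, 0) = 0 ∧
          (∀ p ∈ ball (0 : ℂ × ℂ) r, ∀ q ∈ ball (0 : ℂ × ℂ) r,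
            L⁻¹ * ‖p - q‖ ≤ ‖H (t, p) - H (t, q)‖ ∧
            ‖H (t, p) - H (t, q)‖ ≤ L * ‖p - q‖) ∧
          ((fun p => H (t, p)) '' ball (0 : ℂ × ℂ) r ∈ nhds (0 : ℂ × ℂ)) ∧
          ∀ p ∈ ball (0 : ℂ × ℂ) r, F (t, H (t, p)) = F (t₀, p) := by
  set z₀ : ℂ × ℂ × (ℂ × ℂ) := (t₀, 0, 0) with hz₀
  have mem_proj {z : ℂ × ℂ × (ℂ × ℂ)} (hz : z ∈ ball z₀ δ) :
      (z.1, z.2.2) ∈ ball (t₀, (0 : ℂ × ℂ)) δ := by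
    simp only [mem_ball, Prod.dist_eq, z₀, max_lt_iff] at hz ⊢
    exact ⟨hz.1, hz.2.2⟩
  have hU₀ : LipschitzOnWith (2 * K * δ.toNNReal)
      (fun z : ℂ × ℂ × (ℂ × ℂ) => z.2.1 • V (z.1, z.2.2)) (ball z₀ δ) := by
    refine LipschitzOnWith.of_dist_le_mul fun z hz z' hz' => ?_
    have hVd := hV.dist_le_mul _ (mem_proj hz) _ (mem_proj hz')
    have hVn := hV.dist_le_mul _ (mem_proj hz') (t₀, 0) (mem_ball_self hδ)
    rw [hV0, dist_zero_right] at hVn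
    have hVn' : ‖V (z'.1, z'.2.2)‖ ≤ K * δ :=
      hVn.trans (by gcongr; exact (mem_ball.1 (mem_proj hz')).le)
    have hd : dist (z.1, z.2.2) (z'.1, z'.2.2) ≤ dist z z' := by
      simp only [Prod.dist_eq]
      exact max_le_max le_rfl (le_max_right _ _)
    have hσ : ‖z.2.1 - z'.2.1‖ ≤ dist z z' := by
      rw [← dist_eq_norm]
      simp only [Prod.dist_eq]
      exact (le_max_left _ _).trans (le_max_right _ _)
    have hσ' : ‖z.2.1‖ ≤ δ := by
      simp only [mem_ball, Prod.dist_eq, z₀, max_lt_iff, dist_zero_right] at hz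
      exact hz.2.1.le
    rw [dist_eq_norm] at hVd ⊢
    have : z.2.1 • V (z.1, z.2.2) - z'.2.1 • V (z'.1, z'.2.2) =
        z.2.1 • (V (z.1, z.2.2) - V (z'.1, z'.2.2)) + (z.2.1 - z'.2.1) • V (z'.1, z'.2.2) := by
      module
    rw [this]
    refine (norm_add_le _ _).trans ?_
    rw [norm_smul, norm_smul]
    push_cast
    rw [Real.coe_toNNReal _ hδ.le]
    calc _ ≤ δ * (K * dist z z') + dist z z' * (K * δ) := by
          gcongr
          exact hVd.trans (by gcongr)
      _ = 2 * K * δ * dist z z' := by ring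
  obtain ⟨U, hU, hUV⟩ := hU₀.extend_finite_dimension
  set W : ℂ × ℂ × (ℂ × ℂ) → ℂ × ℂ × (ℂ × ℂ) := fun z => (z.2.1, 0, U z) with hWdef
  have hW : ∃ K' : ℝ≥0, 0 < K' ∧ LipschitzWith K' W := by
    have h1 := (LipschitzWith.prod_fst.comp LipschitzWith.prod_snd :
      LipschitzWith _ (fun z : ℂ × ℂ × (ℂ × ℂ) => z.2.1))
    have h2 := (LipschitzWith.const (α := ℂ × ℂ × (ℂ × ℂ)) (0 : ℂ)).prodMk hU
    exact ⟨_, by simp, h1.prodMk h2⟩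
  obtain ⟨K', hK', hW⟩ := hW
  have hWz₀ : W z₀ = 0 := by
    have : U z₀ = 0 := by rw [← hUV (mem_ball_self hδ)]; simp [z₀]
    simp [W, this, z₀]
  obtain ⟨ε, hε, Φ, hΦ, hΦs, huniq, hcurve⟩ := exists_flow_of_lipschitzWith hK' hW hWz₀
  have hεmem : ε ∈ Icc 0 ε := ⟨hε.le, le_rfl⟩
  have right {G : Type} [NormedAddCommGroup G] [NormedSpace ℝ G] {g : ℝ → G}
      (h : ∀ τ ∈ Icc 0 ε, HasDerivWithinAt g 0 (Icc 0 ε) τ) : ∀ τ ∈ Icc 0 ε, g τ = g 0 :=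
    constant_of_has_deriv_right_zero (fun τ hτ => (h τ hτ).continuousWithinAt)
      fun τ hτ => (h τ (Ico_subset_Icc_self hτ)).mono_of_mem_nhdsWithin (Icc_mem_nhdsGE_of_mem hτ)
  have comp {γ : ℝ → ℂ × ℂ × (ℂ × ℂ)} (hγ : IsIntegralCurveOn γ (fun _ => W) (Icc 0 ε)) :
      ∀ τ ∈ Icc 0 ε, (γ τ).2.1 = (γ 0).2.1 ∧ (γ τ).1 = (γ 0).1 + τ * (γ 0).2.1 := by
    have h2 : ∀ τ ∈ Icc 0 ε, (γ τ).2.1 = (γ 0).2.1 := right fun τ hτ => by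
      have := (hγ τ hτ).hasFDerivWithinAt.snd.fst.hasDerivWithinAt
      simpa [W] using this
    have h1 : ∀ τ ∈ Icc 0 ε, (γ τ).1 - τ * (γ 0).2.1 = (γ 0).1 - ((0 : ℝ) : ℂ) * (γ 0).2.1 :=
      right fun τ hτ => by
        have := (hγ τ hτ).hasFDerivWithinAt.fst.hasDerivWithinAt
        have h' := this.sub
          (((Complex.ofRealCLM.hasDerivAt (x := τ)).mul_const (γ 0).2.1).hasDerivWithinAt)
        exact h'.congr_deriv (by simp [W, h2 τ hτ])
    refine fun τ hτ => ⟨h2 τ hτ, ?_⟩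
    have := h1 τ hτ
    rw [Complex.ofReal_zero, zero_mul, sub_zero] at this
    rw [← this]; ring
  have Φcomp (z : ℂ × ℂ × (ℂ × ℂ)) : (Φ z).2.1 = z.2.1 ∧ (Φ z).1 = z.1 + ε * z.2.1 := by
    obtain ⟨γ, h0, hγ, -⟩ := hcurve z
    have := comp hγ ε hεmem
    rwa [← huniq γ hγ, h0] at this
  have hmemz {σ : ℂ} {p : ℂ × ℂ} (hσ : ‖σ‖ < δ / 2) (hp : ‖p‖ < δ / 2) :
      dist (t₀, σ, p) z₀ < δ / 2 := by
    simp only [Prod.dist_eq, z₀, dist_self, dist_zero_right]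
    exact max_lt (by positivity) (max_lt hσ hp)
  have Φzero {σ : ℂ} (hσ : ‖σ‖ < δ / 2) : Φ (t₀, σ, 0) = (t₀ + ε * σ, σ, 0) := by
    have hs : ∀ τ ∈ Icc 0 ε, (t₀ + τ * σ, σ, (0 : ℂ × ℂ)) ∈ ball z₀ δ := fun τ hτ => by
      obtain ⟨γ, h0, hγ, hd⟩ := hcurve (t₀, σ, 0)
      have h1 := (comp hγ τ hτ).2
      have h2 : dist (γ τ).1 t₀ ≤ dist (γ τ) z₀ := by
        simp only [Prod.dist_eq, z₀]; exact le_max_left _ _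
      have h3 := hd τ hτ
      have h4 := hmemz hσ (p := 0) (by simpa using hδ)
      rw [h1, h0] at h2
      have h5 : dist (t₀ + τ * σ) t₀ < δ := by linarith
      simp only [mem_ball, Prod.dist_eq, z₀, max_lt_iff, dist_self, dist_zero_right]
      exact ⟨h5, by linarith, hδ⟩
    have := huniq (fun τ => (t₀ + τ * σ, σ, 0)) fun τ hτ => by
      have h1 : HasDerivAt (fun τ : ℝ => t₀ + (τ : ℂ) * σ) σ τ := by
        simpa using ((Complex.ofRealCLM.hasDerivAt (x := τ)).mul_const σ).const_add t₀
      have hU0 : U (t₀ + τ * σ, σ, 0) = 0 := by rw [← hUV (hs τ hτ)]; simp [hV0]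
      simp only [W, hU0]
      exact (h1.prodMk ((hasDerivAt_const τ σ).prodMk
        (hasDerivAt_const τ (0 : ℂ × ℂ)))).hasDerivWithinAt
    simpa using this
  have hεC : (ε : ℂ) ≠ 0 := by exact_mod_cast hε.ne'
  have hσT {t : ℂ} (ht : t ∈ ball t₀ (ε * (δ / 2))) : ‖(t - t₀) / ε‖ < δ / 2 := by
    rw [norm_div, Complex.norm_real, Real.norm_of_nonneg hε.le, div_lt_iff₀ hε, ← dist_eq_norm]
    linarith [mem_ball.1 ht]
  have hσt (t : ℂ) : t₀ + ε * ((t - t₀) / ε) = t := by field_simp; ring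
  have hΦeq (t : ℂ) (p : ℂ × ℂ) : Φ (t₀, (t - t₀) / ε, p) =
      (t, (t - t₀) / ε, (Φ (t₀, (t - t₀) / ε, p)).2.2) := by
    have h := Φcomp (t₀, (t - t₀) / ε, p)
    simp only [hσt] at h
    exact Prod.ext h.2 (Prod.ext h.1 rfl)
  have dist_last (a b : ℂ) (p p' : ℂ × ℂ) : dist (a, b, p) (a, b, p') = ‖p - p'‖ := by
    simp [dist_eq_norm]
  refine ⟨ball t₀ (ε * (δ / 2)), ball_mem_nhds _ (by positivity), δ / 2, 2, by positivity,
    by norm_num, fun w => (Φ (t₀, (w.1 - t₀) / ε, w.2)).2.2, ?_, fun t ht => ⟨?_, ?_, ?_, ?_⟩⟩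
  · have := hΦ.continuous
    fun_prop
  · simp [Φzero (hσT ht)]
  · intro p hp p' hp'
    have h1 := hΦ.dist_le_mul (t₀, (t - t₀) / ε, p) (t₀, (t - t₀) / ε, p')
    have h2 := hΦs.dist_le_mul (Φ (t₀, (t - t₀) / ε, p)) (Φ (t₀, (t - t₀) / ε, p'))
    rw [Φ.symm_apply_apply, Φ.symm_apply_apply, dist_last] at h2
    rw [dist_last] at h1
    rw [hΦeq t p, hΦeq t p', dist_last] at h1 h2
    simp only [NNReal.coe_ofNat] at h1 h2
    exact ⟨by linarith, h1⟩
  · refine mem_of_superset (ball_mem_nhds 0 (show 0 < δ / 4 by positivity)) fun p₁ hp₁ => ?_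
    set z := Φ.symm (t, (t - t₀) / ε, p₁) with hz
    have hΦz : Φ z = (t, (t - t₀) / ε, p₁) := by simp [z]
    have hc := Φcomp z
    rw [hΦz] at hc
    simp only at hc
    have hz1 : z = (t₀, (t - t₀) / ε, z.2.2) := by
      refine Prod.ext ?_ (Prod.ext hc.1.symm rfl)
      have := hc.2
      rw [← hc.1] at this
      have h' := hσt t
      linear_combination -h' - this
    refine ⟨z.2.2, ?_, ?_⟩
    · have h2 := hΦs.dist_le_mul (t, (t - t₀) / ε, p₁) (t, (t - t₀) / ε, 0)
      have h3 : Φ.symm (t, (t - t₀) / ε, 0) = (t₀, (t - t₀) / ε, 0) := by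
        rw [Equiv.symm_apply_eq, Φzero (hσT ht), hσt]
      rw [h3, ← hz, hz1, dist_last, dist_last] at h2
      simp only [sub_zero, NNReal.coe_ofNat] at h2
      rw [mem_ball_zero_iff] at hp₁ ⊢
      linarith
    · simp only [← hz1, hΦz]
  · intro p hp
    rw [mem_ball_zero_iff] at hp
    obtain ⟨γ, h0, hγ, hd⟩ := hcurve (t₀, (t - t₀) / ε, p)
    have hball : ∀ τ ∈ Icc 0 ε, γ τ ∈ ball z₀ δ := fun τ hτ => by
      have := hd τ hτ
      have h' := hmemz (hσT ht) hp
      rw [mem_ball]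
      linarith
    have hconst := right (g := fun τ => F ((γ τ).1, (γ τ).2.2)) fun τ hτ => by
      obtain ⟨F', hF', hzero⟩ := hF _ (mem_proj (hball τ hτ))
      have h1 := (hγ τ hτ).hasFDerivWithinAt.fst.hasDerivWithinAt
      have h2 := (hγ τ hτ).hasFDerivWithinAt.snd.snd.hasDerivWithinAt
      have h3 := (hF'.restrictScalars ℝ).comp_hasDerivWithinAt τ (h1.prodMk h2)
      have h4 : F' ((γ τ).2.1, U (γ τ)) = 0 := by
        rw [← hUV (hball τ hτ)]
        have : ((γ τ).2.1, (γ τ).2.1 • V ((γ τ).1, (γ τ).2.2)) =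
          (γ τ).2.1 • ((1 : ℂ), V ((γ τ).1, (γ τ).2.2)) := by simp
        simp only [this, map_smul, hzero, smul_zero]
      simpa [W, h4, Function.comp_def] using h3
    have := hconst ε hεmem
    rw [← huniq γ hγ, h0, hΦeq] at this
    simpa using this

end Trivialization

section WeightedBounds

open Set Metric
open scoped NNReal

/-- `f` is differentiable on `S`, of weighted order at least `k` with respect to the weight `ρ`, and
each differentiation lowers this order by at most `3`. -/
def WeightedBoundOn {Z : Type*} [NormedAddCommGroup Z] [NormedSpace ℝ Z] (ρ : Z → ℝ) (S : Set Z)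
    (k : ℕ) (f : Z → ℂ) : Prop :=
  ∃ C : ℝ, 0 ≤ C ∧ ∀ z ∈ S, ∃ f' : Z →L[ℝ] ℂ, HasFDerivAt f f' z ∧
    ‖f z‖ ≤ C * ρ z ^ k ∧ ‖f'‖ * ρ z ^ 3 ≤ C * ρ z ^ k

namespace WeightedBoundOn

variable {Z : Type*} [NormedAddCommGroup Z] [NormedSpace ℝ Z] {ρ : Z → ℝ} {S : Set Z} {k l : ℕ}
  {f g : Z → ℂ}

lemma const (c : ℂ) : WeightedBoundOn ρ S 0 fun _ => c :=
  ⟨‖c‖, norm_nonneg c, fun z _ => ⟨0, hasFDerivAt_const c z, by simp, by simp⟩⟩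

lemma clm (A : Z →L[ℝ] ℂ) (hρ : ∀ z ∈ S, 0 ≤ ρ z ∧ ρ z ≤ 1) (hk : k ≤ 3)
    {C : ℝ} (h : ∀ z ∈ S, ‖A z‖ ≤ C * ρ z ^ k) : WeightedBoundOn ρ S k A := by
  refine ⟨max ‖A‖ C, (norm_nonneg A).trans (le_max_left _ _), fun z hz =>
    ⟨A, A.hasFDerivAt, (h z hz).trans ?_, ?_⟩⟩
  · have := (hρ z hz).1
    gcongr
    exact le_max_right _ _
  · have h0 := (hρ z hz).1
    have : ρ z ^ 3 ≤ ρ z ^ k := pow_le_pow_of_le_one h0 (hρ z hz).2 hk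
    gcongr
    exact le_max_left _ _

lemma mono (hρ : ∀ z ∈ S, 0 ≤ ρ z ∧ ρ z ≤ 1) (hf : WeightedBoundOn ρ S l f) (hkl : k ≤ l) :
    WeightedBoundOn ρ S k f := by
  obtain ⟨C, hC, h⟩ := hf
  refine ⟨C, hC, fun z hz => ?_⟩
  obtain ⟨f', hf', h1, h2⟩ := h z hz
  have : C * ρ z ^ l ≤ C * ρ z ^ k := by
    gcongr C * ?_
    exact pow_le_pow_of_le_one (hρ z hz).1 (hρ z hz).2 hkl
  exact ⟨f', hf', h1.trans this, h2.trans this⟩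

lemma add (hρ : ∀ z ∈ S, 0 ≤ ρ z) (hf : WeightedBoundOn ρ S k f) (hg : WeightedBoundOn ρ S k g) :
    WeightedBoundOn ρ S k fun z => f z + g z := by
  obtain ⟨C, hC, h⟩ := hf
  obtain ⟨D, hD, h'⟩ := hg
  refine ⟨C + D, add_nonneg hC hD, fun z hz => ?_⟩
  obtain ⟨f', hf', h1, h2⟩ := h z hz
  obtain ⟨g', hg', h3, h4⟩ := h' z hz
  have := hρ z hz
  refine ⟨f' + g', hf'.add hg', (norm_add_le _ _).trans (by linarith), ?_⟩
  calc ‖f' + g'‖ * ρ z ^ 3 ≤ (‖f'‖ + ‖g'‖) * ρ z ^ 3 := by gcongr; exact norm_add_le _ _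
    _ ≤ (C + D) * ρ z ^ k := by linarith

lemma mul (hρ : ∀ z ∈ S, 0 ≤ ρ z) (hf : WeightedBoundOn ρ S k f) (hg : WeightedBoundOn ρ S l g) :
    WeightedBoundOn ρ S (k + l) fun z => f z * g z := by
  obtain ⟨C, hC, h⟩ := hf
  obtain ⟨D, hD, h'⟩ := hg
  refine ⟨2 * (C * D), by positivity, fun z hz => ?_⟩
  obtain ⟨f', hf', h1, h2⟩ := h z hz
  obtain ⟨g', hg', h3, h4⟩ := h' z hz
  have hz0 := hρ z hz
  refine ⟨f z • g' + g z • f', hf'.mul hg', ?_, ?_⟩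
  · rw [norm_mul, pow_add]
    calc ‖f z‖ * ‖g z‖ ≤ (C * ρ z ^ k) * (D * ρ z ^ l) := by gcongr
      _ ≤ 2 * (C * D) * (ρ z ^ k * ρ z ^ l) := by
        have : 0 ≤ C * D * (ρ z ^ k * ρ z ^ l) := by positivity
        linarith
  · calc ‖f z • g' + g z • f'‖ * ρ z ^ 3
        ≤ (‖f z‖ * ‖g'‖ + ‖g z‖ * ‖f'‖) * ρ z ^ 3 := by
          gcongr
          exact (norm_add_le _ _).trans (by rw [norm_smul, norm_smul])
      _ = ‖f z‖ * (‖g'‖ * ρ z ^ 3) + ‖g z‖ * (‖f'‖ * ρ z ^ 3) := by ring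
      _ ≤ (C * ρ z ^ k) * (D * ρ z ^ l) + (D * ρ z ^ l) * (C * ρ z ^ k) := by gcongr
      _ = 2 * (C * D) * ρ z ^ (k + l) := by ring

lemma pow (hρ : ∀ z ∈ S, 0 ≤ ρ z) (hf : WeightedBoundOn ρ S k f) (n : ℕ) :
    WeightedBoundOn ρ S (n * k) fun z => f z ^ n := by
  induction n with
  | zero => simpa using const (ρ := ρ) (S := S) 1
  | succ n ih => simpa [pow_succ, add_mul] using ih.mul hρ hf

lemma star (hf : WeightedBoundOn ρ S k f) :
    WeightedBoundOn ρ S k fun z => (starRingEnd ℂ) (f z) := by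
  obtain ⟨C, hC, h⟩ := hf
  refine ⟨C, hC, fun z hz => ?_⟩
  obtain ⟨f', hf', h1, h2⟩ := h z hz
  refine ⟨(Complex.conjCLE : ℂ →L[ℝ] ℂ).comp f',
    (Complex.conjCLE : ℂ →L[ℝ] ℂ).hasFDerivAt.comp z hf', by simpa using h1, ?_⟩
  refine le_trans ?_ h2
  have h0 : ‖(Complex.conjCLE : ℂ →L[ℝ] ℂ).comp f'‖ = ‖f'‖ :=
    Complex.conjLIE.toLinearIsometry.norm_toContinuousLinearMap_comp
  rw [h0]

lemma div (hρ : ∀ z ∈ S, 0 < ρ z) (hf : WeightedBoundOn ρ S (k + l) f)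
    (hg : WeightedBoundOn ρ S l g) {c : ℝ} (hc : 0 < c) (hgc : ∀ z ∈ S, c * ρ z ^ l ≤ ‖g z‖) :
    WeightedBoundOn ρ S k fun z => f z / g z := by
  obtain ⟨C, hC, h⟩ := hf
  obtain ⟨D, hD, h'⟩ := hg
  refine ⟨C / c + C * D / c ^ 2, by positivity, fun z hz => ?_⟩
  obtain ⟨f', hf', h1, h2⟩ := h z hz
  obtain ⟨g', hg', h3, h4⟩ := h' z hz
  have hz0 := hρ z hz
  have hgz := hgc z hz
  have hgpos : 0 < ‖g z‖ := lt_of_lt_of_le (by positivity) hgz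
  have hg0 : g z ≠ 0 := norm_pos_iff.1 hgpos
  have hinv : HasFDerivAt (fun z => (g z)⁻¹) (-(g z ^ 2)⁻¹ • g') z := by
    have := ((hasDerivAt_inv hg0).hasFDerivAt.restrictScalars ℝ).comp z hg'
    refine this.congr_fderiv ?_
    ext v
    simp [mul_comm]
  have hq : ‖f z‖ / ‖g z‖ ≤ C / c * ρ z ^ k := by
    rw [div_le_iff₀ hgpos]
    calc ‖f z‖ ≤ C * ρ z ^ (k + l) := h1
      _ = C / c * ρ z ^ k * (c * ρ z ^ l) := by field_simp; ring
      _ ≤ C / c * ρ z ^ k * ‖g z‖ := by gcongr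
  have hq' : ‖f'‖ * ρ z ^ 3 / ‖g z‖ ≤ C / c * ρ z ^ k := by
    rw [div_le_iff₀ hgpos]
    calc ‖f'‖ * ρ z ^ 3 ≤ C * ρ z ^ (k + l) := h2
      _ = C / c * ρ z ^ k * (c * ρ z ^ l) := by field_simp; ring
      _ ≤ C / c * ρ z ^ k * ‖g z‖ := by gcongr
  have hq'' : ‖g'‖ * ρ z ^ 3 / ‖g z‖ ≤ D / c := by
    rw [div_le_iff₀ hgpos]
    calc ‖g'‖ * ρ z ^ 3 ≤ D * ρ z ^ l := h4
      _ = D / c * (c * ρ z ^ l) := by field_simp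
      _ ≤ D / c * ‖g z‖ := by gcongr
  have hpos : 0 ≤ C * D / c ^ 2 * ρ z ^ k := by positivity
  refine ⟨f z • (-(g z ^ 2)⁻¹ • g') + (g z)⁻¹ • f', ?_, ?_, ?_⟩
  · simp only [div_eq_mul_inv]
    exact hf'.mul hinv
  · rw [norm_div]
    linarith
  · calc ‖f z • (-(g z ^ 2)⁻¹ • g') + (g z)⁻¹ • f'‖ * ρ z ^ 3
        ≤ (‖f z‖ * (‖g z‖ ^ 2)⁻¹ * ‖g'‖ + ‖g z‖⁻¹ * ‖f'‖) * ρ z ^ 3 := by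
          gcongr
          refine (norm_add_le _ _).trans (le_of_eq ?_)
          simp [norm_smul, mul_assoc]
      _ = ‖f z‖ / ‖g z‖ * (‖g'‖ * ρ z ^ 3 / ‖g z‖) + ‖f'‖ * ρ z ^ 3 / ‖g z‖ := by
          field_simp
      _ ≤ C / c * ρ z ^ k * (D / c) + C / c * ρ z ^ k := by gcongr
      _ = (C / c + C * D / c ^ 2) * ρ z ^ k := by field_simp; ring

end WeightedBoundOn

/-- The quasi-homogeneous weight of a point `(t, (x, y))`, for which `x` has weight `3` and `y` has
weight `2`. -/
noncomputable def cuspWeight (z : ℂ × (ℂ × ℂ)) : ℝ := max (‖z.2.1‖ ^ (1 / 3 : ℝ)) √‖z.2.2‖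

lemma cuspWeight_nonneg (z : ℂ × (ℂ × ℂ)) : 0 ≤ cuspWeight z :=
  (Real.sqrt_nonneg _).trans (le_max_right _ _)

lemma rpow_third_pow {a : ℝ} (ha : 0 ≤ a) : (a ^ (1 / 3 : ℝ)) ^ 3 = a := by
  rw [← Real.rpow_natCast, ← Real.rpow_mul ha]; norm_num

lemma norm_fst_le_cuspWeight (z : ℂ × (ℂ × ℂ)) : ‖z.2.1‖ ≤ cuspWeight z ^ 3 := by
  calc ‖z.2.1‖ = (‖z.2.1‖ ^ (1 / 3 : ℝ)) ^ 3 := (rpow_third_pow (norm_nonneg _)).symm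
    _ ≤ cuspWeight z ^ 3 := by gcongr; exact le_max_left _ _

lemma norm_snd_le_cuspWeight (z : ℂ × (ℂ × ℂ)) : ‖z.2.2‖ ≤ cuspWeight z ^ 2 := by
  calc ‖z.2.2‖ = √‖z.2.2‖ ^ 2 := (Real.sq_sqrt (norm_nonneg _)).symm
    _ ≤ cuspWeight z ^ 2 := by gcongr; exact le_max_right _ _

lemma cuspWeight_pow_eq (z : ℂ × (ℂ × ℂ)) (n : ℕ) :
    cuspWeight z ^ (6 * n) = max (‖z.2.1‖ ^ (2 * n)) (‖z.2.2‖ ^ (3 * n)) := by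
  have h3 := rpow_third_pow (norm_nonneg z.2.1)
  have h2 := Real.sq_sqrt (norm_nonneg z.2.2)
  have hmono : MonotoneOn (fun a : ℝ => a ^ (6 * n)) (Ici 0) := fun a ha b _ hab =>
    pow_le_pow_left₀ ha hab _
  have := hmono.map_max (a := ‖z.2.1‖ ^ (1 / 3 : ℝ)) (b := √‖z.2.2‖)
    (Real.rpow_nonneg (norm_nonneg _) _) (Real.sqrt_nonneg _)
  rw [cuspWeight, this]
  congr 1
  · rw [show 6 * n = 3 * (2 * n) by ring, pow_mul, h3]
  · rw [show 6 * n = 2 * (3 * n) by ring, pow_mul, h2]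

lemma cuspWeight_cube_le {z : ℂ × (ℂ × ℂ)} (hz : ‖z.2‖ ≤ 1) : cuspWeight z ^ 3 ≤ ‖z.2‖ := by
  have hy : ‖z.2.2‖ ≤ ‖z.2‖ := norm_snd_le z.2
  have hx : ‖z.2.1‖ ≤ ‖z.2‖ := norm_fst_le z.2
  have h := cuspWeight_pow_eq z 1
  refine le_of_sq_le_sq ?_ (norm_nonneg _)
  calc (cuspWeight z ^ 3) ^ 2 = cuspWeight z ^ (6 * 1) := by ring
    _ = max (‖z.2.1‖ ^ (2 * 1)) (‖z.2.2‖ ^ (3 * 1)) := h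
    _ ≤ ‖z.2‖ ^ 2 := by
      refine max_le (by simpa using pow_le_pow_left₀ (norm_nonneg _) hx 2) ?_
      calc ‖z.2.2‖ ^ (3 * 1) ≤ ‖z.2‖ ^ 3 := by simpa using pow_le_pow_left₀ (norm_nonneg _) hy 3
        _ ≤ ‖z.2‖ ^ 2 := pow_le_pow_of_le_one (norm_nonneg _) hz (by norm_num)

lemma cuspWeight_pos {z : ℂ × (ℂ × ℂ)} (hz : z.2 ≠ 0) : 0 < cuspWeight z := by
  refine (cuspWeight_nonneg z).lt_of_ne' fun h => hz ?_
  have h1 := norm_fst_le_cuspWeight z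
  have h2 := norm_snd_le_cuspWeight z
  simp only [h, ne_eq, OfNat.ofNat_ne_zero, not_false_eq_true, zero_pow, norm_le_zero_iff] at h1 h2
  exact Prod.ext h1 h2

/-- A function of weighted order at least `3` vanishing on the parameter axis is Lipschitz. -/
lemma WeightedBoundOn.exists_lipschitzOnWith {f : ℂ × (ℂ × ℂ) → ℂ} {t₀ : ℂ} {δ : ℝ} (hδ : δ ≤ 1)
    {k : ℕ} (hk : 3 ≤ k)
    (hf : WeightedBoundOn cuspWeight (ball (t₀, (0 : ℂ × ℂ)) δ ∩ {z | z.2 ≠ 0}) k f)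
    (h0 : ∀ t, f (t, 0) = 0) : ∃ K : ℝ≥0, LipschitzOnWith K f (ball (t₀, 0) δ) := by
  have hz1 {z : ℂ × (ℂ × ℂ)} (hz : z ∈ ball (t₀, (0 : ℂ × ℂ)) δ) : ‖z.2‖ ≤ 1 := by
    simp only [mem_ball, Prod.dist_eq, max_lt_iff] at hz
    rw [← dist_zero_right, Prod.dist_eq]
    exact ((max_lt hz.2.1 hz.2.2).le.trans hδ)
  have hρ {z : ℂ × (ℂ × ℂ)} (hz : z ∈ ball (t₀, (0 : ℂ × ℂ)) δ) : cuspWeight z ≤ 1 :=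
    (pow_le_one_iff_of_nonneg (cuspWeight_nonneg z) (by norm_num : (3 : ℕ) ≠ 0)).1
      ((cuspWeight_cube_le (hz1 hz)).trans (hz1 hz))
  obtain ⟨C, hC, h⟩ := hf.mono (k := 3)
    (fun z hz => ⟨cuspWeight_nonneg z, hρ hz.1⟩) hk
  choose! f' hf' hfn hf'n using h
  have hbound {z : ℂ × (ℂ × ℂ)} (hz : z ∈ ball (t₀, (0 : ℂ × ℂ)) δ) : ‖f z‖ ≤ C * ‖z.2‖ := by
    by_cases hz0 : z.2 = 0
    · have : f z = 0 := by rw [← h0 z.1, ← hz0]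
      simp [this, hz0]
    · exact (hfn z ⟨hz, hz0⟩).trans (by gcongr; exact cuspWeight_cube_le (hz1 hz))
  refine ⟨C.toNNReal, LipschitzOnWith.of_dist_le_mul fun z hz z' hz' => ?_⟩
  rw [Real.coe_toNNReal _ hC]
  have hseg : segment ℝ z z' ⊆ ball (t₀, 0) δ := (convex_ball _ _).segment_subset hz hz'
  by_cases hne : ∀ w ∈ segment ℝ z z', w.2 ≠ 0
  · rw [dist_comm z, dist_comm (f z), dist_eq_norm, dist_eq_norm]
    refine (convex_segment z z').norm_image_sub_le_of_norm_hasFDerivWithin_le (𝕜 := ℝ) (f' := f')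
      (fun w hw => (hf' w ⟨hseg hw, hne w hw⟩).hasFDerivWithinAt) (fun w hw => ?_)
      (left_mem_segment ℝ z z') (right_mem_segment ℝ z z')
    have hp := cuspWeight_pos (hne w hw)
    exact le_of_mul_le_mul_right (hf'n w ⟨hseg hw, hne w hw⟩) (by positivity)
  · push Not at hne
    obtain ⟨w, hw, hw0⟩ := hne
    have hle (v : ℂ × (ℂ × ℂ)) : ‖v.2‖ ≤ dist v w := by
      rw [← dist_zero_right, ← hw0]
      exact le_max_right _ _
    calc dist (f z) (f z') ≤ ‖f z‖ + ‖f z'‖ := by rw [dist_eq_norm]; exact norm_sub_le _ _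
      _ ≤ C * ‖z.2‖ + C * ‖z'.2‖ := add_le_add (hbound hz) (hbound hz')
      _ ≤ C * dist z w + C * dist z' w := by gcongr <;> exact hle _
      _ = C * (dist z w + dist w z') := by rw [dist_comm z' w]; ring
      _ = C * dist z z' := by rw [dist_add_dist_of_mem_segment hw]

end WeightedBounds

section Family

open ComplexConjugate

/-- The coefficient of `x * y ^ (4 + q)` in the family, as a function of `t` and `y`. -/
def wsharpU (s : ℂ) (z : ℂ × (ℂ × ℂ)) : ℂ := s + z.1 * z.2.2

/-- The coefficient of the cubic term of `wsharpP`. -/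
def wsharpV (q : ℕ) (s : ℂ) (z : ℂ × (ℂ × ℂ)) : ℂ :=
  (11 + 2 * q) * s + (13 + 2 * q) * (z.1 * z.2.2)

/-- `x * y ^ (3 + q) * wsharpW` is the partial derivative in `y` of the terms after the square. -/
def wsharpW (q : ℕ) (s : ℂ) (z : ℂ × (ℂ × ℂ)) : ℂ :=
  (4 + q) * s + (5 + q) * (z.1 * z.2.2)

/-- `y ^ (5 + q) * wsharpP` lies in the relative Jacobian ideal. -/
def wsharpP (q : ℕ) (s : ℂ) (z : ℂ × (ℂ × ℂ)) : ℂ :=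
  16 * wsharpV q s z * z.2.1 ^ 3 + 12 * wsharpU s z ^ 2 * z.2.2 ^ (4 + q)

/-- `x * y ^ (5 + q) * wsharpQ` lies in the relative Jacobian ideal. -/
def wsharpQ (q : ℕ) (s : ℂ) (z : ℂ × (ℂ × ℂ)) : ℂ :=
  3 * wsharpU s z * z.2.2 ^ 3 + -2 * wsharpW q s z * z.2.1 ^ 2

/-- The common denominator of the components of the trivializing field: a combination of `wsharpP`
and `wsharpQ` comparable to the 24th power of the weight. -/
def wsharpDenom (q : ℕ) (s : ℂ) (z : ℂ × (ℂ × ℂ)) : ℂ :=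
  conj (wsharpV q s z) * z.2.1 * conj z.2.1 ^ 4 * wsharpP q s z +
    conj (wsharpQ q s z) * (z.2.2 * conj z.2.2) ^ 3 * wsharpQ q s z

/-- The numerator of the first component of the trivializing field. -/
def wsharpNumX (q : ℕ) (s : ℂ) (z : ℂ × (ℂ × ℂ)) : ℂ :=
  conj (wsharpV q s z) * z.2.1 ^ 2 * conj z.2.1 ^ 4 *
      (12 * wsharpU s z * z.2.2 ^ (5 + q) + -48 * z.2.1 * z.2.2 ^ 4) +
    conj (wsharpQ q s z) * (z.2.2 * conj z.2.2) ^ 3 * (3 * z.2.1 * z.2.2 ^ 4)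

/-- The numerator of the second component of the trivializing field. -/
def wsharpNumY (q : ℕ) (s : ℂ) (z : ℂ × (ℂ × ℂ)) : ℂ :=
  conj (wsharpV q s z) * z.2.1 ^ 2 * conj z.2.1 ^ 4 * (32 * z.2.1 ^ 2 * z.2.2 ^ 2) +
    conj (wsharpQ q s z) * (z.2.2 * conj z.2.2) ^ 3 * (-2 * z.2.1 ^ 2 * z.2.2 ^ 2)

lemma wsharp_num_mul_partial (q : ℕ) (s t x y : ℂ) :
    wsharpNumX q s (t, x, y) * (4 * x * (x ^ 2 + y ^ 3) + wsharpU s (t, x, y) * y ^ (4 + q)) +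
      wsharpNumY q s (t, x, y) * (6 * y ^ 2 * (x ^ 2 + y ^ 3) +
        s * x * ((4 + q) * y ^ (3 + q)) + t * x * ((5 + q) * y ^ (4 + q))) =
      x * y ^ (5 + q) * wsharpDenom q s (t, x, y) := by
  simp only [wsharpNumX, wsharpNumY, wsharpDenom]
  generalize conj (wsharpV q s (t, x, y)) = v'
  generalize conj (wsharpQ q s (t, x, y)) = Q'
  generalize conj x = x'
  generalize conj y = y'
  simp only [wsharpP, wsharpQ, wsharpU, wsharpV, wsharpW]
  ring

lemma wsharp_main_term_lower_bound {X Y a u v w Q M : ℝ} (hY : 0 ≤ Y) (ha : 0 < a)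
    (hM : 1 ≤ M) (hu : a / 2 ≤ u) (hv : a ≤ v) (hw : w ≤ M * a / 4)
    (hQ : 3 * u * Y ^ 3 - 2 * w * X ^ 2 ≤ Q) :
    a ^ 2 / M ^ 4 * max (X ^ 8) (Y ^ 12) ≤ 16 * v ^ 2 * X ^ 8 + Q ^ 2 * Y ^ 6 := by
  have hM4 : 1 ≤ M ^ 4 := one_le_pow₀ hM
  rcases le_or_gt (Y ^ 3) (M * X ^ 2) with h | h
  · have h1 : Y ^ 12 ≤ M ^ 4 * X ^ 8 := by
      calc Y ^ 12 = (Y ^ 3) ^ 4 := by ring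
        _ ≤ (M * X ^ 2) ^ 4 := by gcongr
        _ = M ^ 4 * X ^ 8 := by ring
    have h2 : max (X ^ 8) (Y ^ 12) ≤ M ^ 4 * X ^ 8 :=
      max_le (le_mul_of_one_le_left (by positivity) hM4) h1
    calc a ^ 2 / M ^ 4 * max (X ^ 8) (Y ^ 12) ≤ a ^ 2 / M ^ 4 * (M ^ 4 * X ^ 8) := by gcongr
      _ = a ^ 2 * X ^ 8 := by field_simp
      _ ≤ v ^ 2 * X ^ 8 := by gcongr
      _ ≤ 16 * v ^ 2 * X ^ 8 + Q ^ 2 * Y ^ 6 := by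
        have : 0 ≤ v ^ 2 * X ^ 8 := by positivity
        have : 0 ≤ Q ^ 2 * Y ^ 6 := by positivity
        linarith
  · have h1 : X ^ 8 ≤ Y ^ 12 := by
      have : X ^ 2 ≤ Y ^ 3 := (le_mul_of_one_le_left (by positivity) hM).trans h.le
      calc X ^ 8 = (X ^ 2) ^ 4 := by ring
        _ ≤ (Y ^ 3) ^ 4 := by gcongr
        _ = Y ^ 12 := by ring
    have h2 : a * Y ^ 3 ≤ Q := by
      have e1 : 3 * (a / 2) * Y ^ 3 ≤ 3 * u * Y ^ 3 := by gcongr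
      have e2 : 2 * w * X ^ 2 ≤ 2 * (M * a / 4) * X ^ 2 := by gcongr
      have e3 : a * (M * X ^ 2) ≤ a * Y ^ 3 := by gcongr
      linarith
    rw [max_eq_right h1]
    calc a ^ 2 / M ^ 4 * Y ^ 12 ≤ a ^ 2 * Y ^ 12 := by
          gcongr
          exact div_le_self (by positivity) hM4
      _ = (a * Y ^ 3) ^ 2 * Y ^ 6 := by ring
      _ ≤ Q ^ 2 * Y ^ 6 := by gcongr
      _ ≤ 16 * v ^ 2 * X ^ 8 + Q ^ 2 * Y ^ 6 := by
        have : 0 ≤ v ^ 2 * X ^ 8 := by positivity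
        linarith

/-- Close to the origin the denominator is comparable to the 24th power of the weight. -/
lemma exists_wsharpDenom_lower_bound {q : ℕ} (hq : 1 ≤ q) {s : ℂ} (hs : s ≠ 0) {R : ℝ}
    (hR : 0 ≤ R) :
    ∃ η > 0, ∃ c > 0, ∀ z : ℂ × (ℂ × ℂ), ‖z.1‖ ≤ R → cuspWeight z ≤ η →
      c * cuspWeight z ^ 24 ≤ ‖wsharpDenom q s z‖ := by
  have ha : 0 < ‖s‖ := norm_pos_iff.2 hs
  set a := ‖s‖ with ha'
  set M : ℝ := 8 * (4 + q) with hM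
  have hM1 : 1 ≤ M := by
    have : (0 : ℝ) ≤ q := Nat.cast_nonneg q
    linarith
  set C : ℝ := 12 * ((12 + 2 * q) * a) * (2 * a) ^ 2 with hC
  have hCpos : 0 < C := by positivity
  set c : ℝ := a ^ 2 / M ^ 4 with hc
  have hcpos : 0 < c := by positivity
  set η : ℝ := min 1 (min (a / (2 * ((13 + 2 * q) * (R + 1)))) (c / (2 * C))) with hη
  have hη1 : η ≤ 1 := min_le_left _ _
  have hη2 : η ≤ a / (2 * ((13 + 2 * q) * (R + 1))) := (min_le_right _ _).trans (min_le_left _ _)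
  have hη3 : η ≤ c / (2 * C) := (min_le_right _ _).trans (min_le_right _ _)
  refine ⟨η, by positivity, c / 2, by positivity, fun z hzR hzη => ?_⟩
  set ρ := cuspWeight z with hρ
  have hρ0 : 0 ≤ ρ := cuspWeight_nonneg z
  have hρ1 : ρ ≤ 1 := hzη.trans hη1
  have hx := norm_fst_le_cuspWeight z
  have hy := norm_snd_le_cuspWeight z
  rw [← hρ] at hx hy
  have hty : (13 + 2 * q) * ‖z.1 * z.2.2‖ ≤ a / 2 := by
    have h1 : ‖z.2.2‖ ≤ η := hy.trans ((pow_le_of_le_one hρ0 hρ1 (by norm_num)).trans hzη)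
    calc (13 + 2 * q) * ‖z.1 * z.2.2‖ ≤ (13 + 2 * q) * ((R + 1) * η) := by
          rw [norm_mul]; gcongr; linarith
      _ ≤ (13 + 2 * q) * ((R + 1) * (a / (2 * ((13 + 2 * q) * (R + 1))))) := by gcongr
      _ = a / 2 := by field_simp
  have hn (n : ℕ) (m : ℕ) : ‖((n : ℂ) + m * q) * s‖ = (n + m * q) * a := by
    rw [norm_mul, ← ha']; congr 1; exact_mod_cast Complex.norm_natCast (n + m * q)
  have hn' (n : ℕ) (m : ℕ) (w : ℂ) : ‖((n : ℂ) + m * q) * w‖ = (n + m * q) * ‖w‖ := by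
    rw [norm_mul]; congr 1; exact_mod_cast Complex.norm_natCast (n + m * q)
  have hq0 : (0 : ℝ) ≤ q := Nat.cast_nonneg q
  have hp0 : 0 ≤ ‖z.1 * z.2.2‖ := norm_nonneg _
  have hqp : 0 ≤ q * ‖z.1 * z.2.2‖ := by positivity
  have hqa : 0 ≤ q * a := by positivity
  have hu1 : a / 2 ≤ ‖wsharpU s z‖ := by
    have := norm_sub_le_norm_add s (z.1 * z.2.2)
    rw [wsharpU]; linarith
  have hu2 : ‖wsharpU s z‖ ≤ 2 * a := by
    have := norm_add_le s (z.1 * z.2.2)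
    rw [wsharpU]; linarith
  have hv1 : a ≤ ‖wsharpV q s z‖ := by
    have h := norm_sub_le_norm_add ((11 + 2 * q) * s) ((13 + 2 * q) * (z.1 * z.2.2))
    have e1 := hn 11 2
    have e2 := hn' 13 2 (z.1 * z.2.2)
    push_cast at e1 e2
    rw [e1, e2] at h
    rw [wsharpV]; linarith
  have hv2 : ‖wsharpV q s z‖ ≤ (12 + 2 * q) * a := by
    have h := norm_add_le ((11 + 2 * q) * s) ((13 + 2 * q) * (z.1 * z.2.2))
    have e1 := hn 11 2
    have e2 := hn' 13 2 (z.1 * z.2.2)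
    push_cast at e1 e2
    rw [e1, e2] at h
    rw [wsharpV]; linarith
  have hw : ‖wsharpW q s z‖ ≤ M * a / 4 := by
    have h := norm_add_le ((4 + q) * s) ((5 + q) * (z.1 * z.2.2))
    have e1 := hn 4 1
    have e2 := hn' 5 1 (z.1 * z.2.2)
    push_cast at e1 e2
    rw [one_mul] at e1 e2
    rw [one_mul] at e1 e2
    rw [e1, e2] at h
    rw [wsharpW]; linarith
  have hQ : 3 * ‖wsharpU s z‖ * ‖z.2.2‖ ^ 3 - 2 * ‖wsharpW q s z‖ * ‖z.2.1‖ ^ 2 ≤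
      ‖wsharpQ q s z‖ := by
    have := norm_sub_le_norm_add (3 * wsharpU s z * z.2.2 ^ 3) (-2 * wsharpW q s z * z.2.1 ^ 2)
    simpa [wsharpQ] using this
  have hmain := wsharp_main_term_lower_bound (norm_nonneg z.2.2) ha hM1 hu1 hv1 hw hQ
  have hmax : max (‖z.2.1‖ ^ 8) (‖z.2.2‖ ^ 12) = ρ ^ 24 := by
    simpa using (cuspWeight_pow_eq z 4).symm
  rw [hmax] at hmain
  set main : ℝ := 16 * ‖wsharpV q s z‖ ^ 2 * ‖z.2.1‖ ^ 8 + ‖wsharpQ q s z‖ ^ 2 * ‖z.2.2‖ ^ 6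
    with hmaindef
  set err : ℂ := 12 * conj (wsharpV q s z) * (wsharpU s z) ^ 2 *
    (z.2.1 * conj z.2.1 ^ 4 * z.2.2 ^ (4 + q)) with herr
  have hD : wsharpDenom q s z = (main : ℂ) + err := by
    calc wsharpDenom q s z = 16 * (conj (wsharpV q s z) * wsharpV q s z) *
          (conj z.2.1 * z.2.1) ^ 4 + (conj (wsharpQ q s z) * wsharpQ q s z) *
          (conj z.2.2 * z.2.2) ^ 3 + err := by
            simp only [wsharpDenom, wsharpP, err]; ring
      _ = main + err := by
        simp only [Complex.conj_mul', main]
        push_cast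
        ring
  have herr_le : ‖err‖ ≤ C * ρ ^ 25 := by
    calc ‖err‖ = 12 * ‖wsharpV q s z‖ * ‖wsharpU s z‖ ^ 2 *
          (‖z.2.1‖ * ‖z.2.1‖ ^ 4 * ‖z.2.2‖ ^ (4 + q)) := by simp [err]
      _ ≤ 12 * ((12 + 2 * q) * a) * (2 * a) ^ 2 * (ρ ^ 3 * (ρ ^ 3) ^ 4 * (ρ ^ 2) ^ (4 + q)) := by
        gcongr
      _ = C * ρ ^ (23 + 2 * q) := by rw [hC]; ring
      _ ≤ C * ρ ^ 25 := by
        gcongr C * ?_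
        exact pow_le_pow_of_le_one hρ0 hρ1 (by omega)
  have herr_le' : ‖err‖ ≤ c / 2 * ρ ^ 24 := by
    calc ‖err‖ ≤ C * ρ * ρ ^ 24 := herr_le.trans (le_of_eq (by ring))
      _ ≤ C * (c / (2 * C)) * ρ ^ 24 := by gcongr; exact hzη.trans hη3
      _ = c / 2 * ρ ^ 24 := by field_simp
  have hmain0 : 0 ≤ main := by positivity
  have := norm_sub_le_norm_add (main : ℂ) err
  rw [Complex.norm_real, Real.norm_of_nonneg hmain0] at this
  rw [hD]
  linarith

/-- Weighted orders of the numerators and of the denominator. -/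
lemma wsharp_weightedBoundOn (q : ℕ) (hq : 1 ≤ q) (s : ℂ) {S : Set (ℂ × (ℂ × ℂ))} {R : ℝ}
    (hS : ∀ z ∈ S, ‖z.1‖ ≤ R ∧ cuspWeight z ≤ 1) :
    WeightedBoundOn cuspWeight S 29 (wsharpNumX q s) ∧
      WeightedBoundOn cuspWeight S 28 (wsharpNumY q s) ∧
      WeightedBoundOn cuspWeight S 24 (wsharpDenom q s) := by
  have hρ : ∀ z ∈ S, 0 ≤ cuspWeight z := fun z _ => cuspWeight_nonneg z
  have hρ1 : ∀ z ∈ S, 0 ≤ cuspWeight z ∧ cuspWeight z ≤ 1 := fun z hz => ⟨hρ z hz, (hS z hz).2⟩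
  have ht : WeightedBoundOn cuspWeight S 0 fun z : ℂ × (ℂ × ℂ) => z.1 :=
    .clm (ContinuousLinearMap.fst ℝ ℂ (ℂ × ℂ)) hρ1 (by norm_num) (C := R)
      fun z hz => by simpa using (hS z hz).1
  have hx : WeightedBoundOn cuspWeight S 3 fun z : ℂ × (ℂ × ℂ) => z.2.1 :=
    .clm ((ContinuousLinearMap.fst ℝ ℂ ℂ).comp (ContinuousLinearMap.snd ℝ ℂ (ℂ × ℂ))) hρ1 le_rfl
      (C := 1) fun z _ => by simpa using norm_fst_le_cuspWeight z
  have hy : WeightedBoundOn cuspWeight S 2 fun z : ℂ × (ℂ × ℂ) => z.2.2 :=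
    .clm ((ContinuousLinearMap.snd ℝ ℂ ℂ).comp (ContinuousLinearMap.snd ℝ ℂ (ℂ × ℂ))) hρ1
      (by norm_num) (C := 1) fun z _ => by simpa using norm_snd_le_cuspWeight z
  have hty := (ht.mul hρ hy).mono hρ1 (Nat.zero_le _)
  have hcst (c : ℂ) : WeightedBoundOn cuspWeight S 0 fun _ => c := .const c
  have hu : WeightedBoundOn cuspWeight S 0 (wsharpU s) := (hcst s).add hρ hty
  have hv : WeightedBoundOn cuspWeight S 0 (wsharpV q s) :=
    (hcst _).add hρ ((hcst _).mul hρ hty)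
  have hw : WeightedBoundOn cuspWeight S 0 (wsharpW q s) :=
    (hcst _).add hρ ((hcst _).mul hρ hty)
  have hP : WeightedBoundOn cuspWeight S 9 (wsharpP q s) :=
    (((hcst 16).mul hρ hv).mul hρ (hx.pow hρ 3)).add hρ
      ((((hcst 12).mul hρ (hu.pow hρ 2)).mul hρ (hy.pow hρ (4 + q))).mono hρ1 (by omega))
  have hQ : WeightedBoundOn cuspWeight S 6 (wsharpQ q s) :=
    (((hcst 3).mul hρ hu).mul hρ (hy.pow hρ 3)).add hρ
      (((hcst (-2)).mul hρ hw).mul hρ (hx.pow hρ 2))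
  have hQy := hQ.star.mul hρ ((hy.mul hρ hy.star).pow hρ 3)
  have hvx := (hv.star.mul hρ (hx.pow hρ 2)).mul hρ (hx.star.pow hρ 4)
  refine ⟨?_, ?_, ?_⟩
  · have h1 : WeightedBoundOn cuspWeight S 11 fun z : ℂ × (ℂ × ℂ) =>
        12 * wsharpU s z * z.2.2 ^ (5 + q) + -48 * z.2.1 * z.2.2 ^ 4 :=
      ((((hcst 12).mul hρ hu).mul hρ (hy.pow hρ (5 + q))).mono hρ1 (by omega)).add hρ
        (((hcst (-48)).mul hρ hx).mul hρ (hy.pow hρ 4))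
    exact (hvx.mul hρ h1).add hρ (hQy.mul hρ (((hcst 3).mul hρ hx).mul hρ (hy.pow hρ 4)))
  · exact (hvx.mul hρ (((hcst 32).mul hρ (hx.pow hρ 2)).mul hρ (hy.pow hρ 2))).add hρ
      (hQy.mul hρ (((hcst (-2)).mul hρ (hx.pow hρ 2)).mul hρ (hy.pow hρ 2)))
  · exact (((hv.star.mul hρ hx).mul hρ (hx.star.pow hρ 4)).mul hρ hP).add hρ (hQy.mul hρ hQ)

/-- The vector field along which the family is constant. -/
noncomputable def wsharpField (q : ℕ) (s : ℂ) (z : ℂ × (ℂ × ℂ)) : ℂ × ℂ :=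
  (-(wsharpNumX q s z / wsharpDenom q s z), -(wsharpNumY q s z / wsharpDenom q s z))

lemma wsharpField_zero (q : ℕ) (s t : ℂ) : wsharpField q s (t, 0) = 0 := by
  simp [wsharpField, wsharpNumX, wsharpNumY]

lemma exists_hasFDerivAt_wsharp (q : ℕ) (s : ℂ) {z : ℂ × (ℂ × ℂ)}
    (hz : z.2 ≠ 0 → wsharpDenom q s z ≠ 0) :
    ∃ F' : ℂ × (ℂ × ℂ) →L[ℂ] ℂ,
      HasFDerivAt (fun z : ℂ × (ℂ × ℂ) => (z.2.1 ^ 2 + z.2.2 ^ 3) ^ 2 + s * z.2.1 * z.2.2 ^ (4 + q) +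
        z.1 * z.2.1 * z.2.2 ^ (5 + q)) F' z ∧ F' (1, wsharpField q s z) = 0 := by
  obtain ⟨t, x, y⟩ := z
  have ht : HasFDerivAt (fun z : ℂ × (ℂ × ℂ) => z.1) (.fst ℂ ℂ (ℂ × ℂ)) (t, x, y) := hasFDerivAt_fst
  have hp : HasFDerivAt (fun z : ℂ × (ℂ × ℂ) => z.2) (.snd ℂ ℂ (ℂ × ℂ)) (t, x, y) := hasFDerivAt_snd
  have hx := hp.fst
  have hy := hp.snd
  refine ⟨_, ((((hx.pow 2).add (hy.pow 3)).pow 2).add ((hx.const_mul s).mul (hy.pow (4 + q)))).add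
    ((ht.mul hx).mul (hy.pow (5 + q))), ?_⟩
  have e1 : 4 + q - 1 = 3 + q := by omega
  have e2 : 5 + q - 1 = 4 + q := by omega
  by_cases h0 : (x, y) = 0
  · obtain ⟨rfl, rfl⟩ := Prod.mk_eq_zero.1 h0
    have : wsharpField q s (t, 0, 0) = 0 := wsharpField_zero q s t
    simp [this]
  · have hD := hz h0
    have h := wsharp_num_mul_partial q s t x y
    simp only [wsharpU] at h
    simp [wsharpField, e1, e2]
    field_simp
    linear_combination -h

lemma exists_lipschitzOnWith_wsharpField {q : ℕ} (hq : 1 ≤ q) {s : ℂ} (hs : s ≠ 0) (t₀ : ℂ) :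
    ∃ δ > 0, (∃ K, LipschitzOnWith K (wsharpField q s) (Metric.ball (t₀, 0) δ)) ∧
      ∀ z ∈ Metric.ball (t₀, (0 : ℂ × ℂ)) δ, z.2 ≠ 0 → wsharpDenom q s z ≠ 0 := by
  obtain ⟨η, hη, c, hc, hbound⟩ :=
    exists_wsharpDenom_lower_bound hq hs (R := ‖t₀‖ + 1) (by positivity)
  set m := min 1 η with hm
  have hm0 : 0 < m := by positivity
  have hm1 : m ≤ 1 := min_le_left _ _
  have hδ : m ^ 3 ≤ 1 := pow_le_one₀ hm0.le hm1
  have hball : ∀ z ∈ Metric.ball (t₀, (0 : ℂ × ℂ)) (m ^ 3), ‖z.1‖ ≤ ‖t₀‖ + 1 ∧ cuspWeight z ≤ m := by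
    intro z hz
    rw [Metric.mem_ball, Prod.dist_eq, max_lt_iff, dist_eq_norm, dist_zero_right] at hz
    refine ⟨?_, ?_⟩
    · have := norm_le_norm_add_norm_sub' z.1 t₀
      linarith [hz.1]
    · refine (pow_le_pow_iff_left₀ (cuspWeight_nonneg z) hm0.le three_ne_zero).1 ?_
      exact (cuspWeight_cube_le (hz.2.le.trans hδ)).trans hz.2.le
  have hlow : ∀ z ∈ Metric.ball (t₀, (0 : ℂ × ℂ)) (m ^ 3),
      c * cuspWeight z ^ 24 ≤ ‖wsharpDenom q s z‖ := fun z hz =>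
    hbound z (hball z hz).1 ((hball z hz).2.trans (min_le_right _ _))
  refine ⟨m ^ 3, by positivity, ?_, fun z hz hz0 => ?_⟩
  · obtain ⟨hX, hY, hD⟩ := wsharp_weightedBoundOn q hq s
      (S := Metric.ball (t₀, (0 : ℂ × ℂ)) (m ^ 3) ∩ {z | z.2 ≠ 0}) (R := ‖t₀‖ + 1)
      fun z hz => ⟨(hball z hz.1).1, (hball z hz.1).2.trans hm1⟩
    have hpos : ∀ z ∈ Metric.ball (t₀, (0 : ℂ × ℂ)) (m ^ 3) ∩ {z | z.2 ≠ 0}, 0 < cuspWeight z :=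
      fun z hz => cuspWeight_pos hz.2
    obtain ⟨K₁, hK₁⟩ := (hX.div (k := 5) hpos hD hc fun z hz => hlow z hz.1).exists_lipschitzOnWith
      hδ (by norm_num) (by simp [wsharpNumX])
    obtain ⟨K₂, hK₂⟩ := (hY.div (k := 4) hpos hD hc fun z hz => hlow z hz.1).exists_lipschitzOnWith
      hδ (by norm_num) (by simp [wsharpNumY])
    exact ⟨_, hK₁.neg.prodMk hK₂.neg⟩
  · have := cuspWeight_pos hz0
    exact norm_pos_iff.1 (lt_of_lt_of_le (by positivity) (hlow z hz))

end Family

/-- The family Wsharp_odd, `F t = fun (x,y) => (w.1 ^ 2 + w.2 ^ 3) ^ 2 + s * w.1 * w.2 ^ (4 + q) + τ * w.1 * w.2 ^ (5 + q)`, is Lipschitz trivial in `t` over `ℂ`: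
for every `t₀` there are a neighborhood `T` of `t₀`, `r > 0`, `L ≥ 1`, and a
continuous family `H` of bi-Lipschitz homeomorphisms with `F t ∘ H t = F t₀` on
`B(0,r)`. -/
theorem lipschitz_trivial_Wsharp_odd (q : ℕ) (hq : 1 ≤ q) (s : ℂ) (hs : s ≠ 0) (t₀ : ℂ) :
    ∃ T ∈ nhds t₀, ∃ r L : ℝ, 0 < r ∧ 1 ≤ L ∧
      ∃ H : ℂ × (ℂ × ℂ) → ℂ × ℂ,
        ContinuousOn H (T ×ˢ Metric.ball (0 : ℂ × ℂ) r) ∧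
        ∀ t ∈ T,
          H (t, 0) = 0 ∧
          (∀ p ∈ Metric.ball (0 : ℂ × ℂ) r, ∀ q ∈ Metric.ball (0 : ℂ × ℂ) r,
            L⁻¹ * ‖p - q‖ ≤ ‖H (t, p) - H (t, q)‖ ∧
            ‖H (t, p) - H (t, q)‖ ≤ L * ‖p - q‖) ∧
          ((fun p => H (t, p)) '' Metric.ball (0 : ℂ × ℂ) r ∈ nhds (0 : ℂ × ℂ)) ∧
          ∀ p ∈ Metric.ball (0 : ℂ × ℂ) r,
            (fun (τ : ℂ) (w : ℂ × ℂ) => (w.1 ^ 2 + w.2 ^ 3) ^ 2 + s * w.1 * w.2 ^ (4 + q) + τ * w.1 * w.2 ^ (5 + q)) t (H (t, p)) =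
            (fun (τ : ℂ) (w : ℂ × ℂ) => (w.1 ^ 2 + w.2 ^ 3) ^ 2 + s * w.1 * w.2 ^ (4 + q) + τ * w.1 * w.2 ^ (5 + q)) t₀ p := by
  obtain ⟨δ, hδ, ⟨K, hK⟩, hD⟩ := exists_lipschitzOnWith_wsharpField hq hs t₀
  exact exists_lipschitz_trivialization
    (fun z => (z.2.1 ^ 2 + z.2.2 ^ 3) ^ 2 + s * z.2.1 * z.2.2 ^ (4 + q) +
      z.1 * z.2.1 * z.2.2 ^ (5 + q))
    (wsharpField q s) t₀ hδ hK (wsharpField_zero q s)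
    fun z hz => exists_hasFDerivAt_wsharp q s (hD z hz)
end

section
/- Fix an integer q ≥ 1 and s ∈ ℂ with s ≠ 0, and define F : ℂ × ℂ² → ℂ by F(t,(x,y)) = (x² + y³)² + s x² y^{3+q} + t x² y^{4+q} (the family W^{#}_{1,2q}). Then F is Lipschitz trivial in t over ℂ: for every t₀ ∈ ℂ there exist a neighborhood T of t₀ in ℂ, a radius r > 0, a constant L ≥ 1, and a continuous map H : T × B(0,r) → ℂ² such that for each t ∈ T: H(t,0) = 0; L⁻¹‖p − q'‖ ≤ ‖H(t,p) − H(t,q')‖ ≤ L‖p − q'‖ for all p, q' ∈ B(0,r); the image H(t, B(0,r)) is a neighborhood of 0 in ℂ²; and F(t, H(t,p)) = F(t₀, p) for all p ∈ B(0,r). -/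
open Filter

open Set Metric Topology
open scoped NNReal ComplexConjugate

section Flow

/-- **Picard-Lindelöf theorem** with the additional information that the solutions stay in the
ball where the vector field is controlled. -/
theorem IsPicardLindelof.exists_forall_mem_closedBall {E : Type*} [NormedAddCommGroup E]
    [NormedSpace ℝ E] [CompleteSpace E] {f : ℝ → E → E} {tmin tmax : ℝ} {t₀ : Icc tmin tmax}
    {x₀ : E} {a r L K : ℝ≥0} (hf : IsPicardLindelof f t₀ x₀ a r L K) :
    ∃ α : E → ℝ → E, ∀ x ∈ closedBall x₀ r, α x t₀ = x ∧ ∀ t ∈ Icc tmin tmax,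
      α x t ∈ closedBall x₀ a ∧ HasDerivWithinAt (α x) (f t (α x t)) (Icc tmin tmax) t := by
  have key : ∀ x, ∃ α : ℝ → E, x ∈ closedBall x₀ r → α t₀ = x ∧ ∀ t ∈ Icc tmin tmax,
      α t ∈ closedBall x₀ a ∧ HasDerivWithinAt α (f t (α t)) (Icc tmin tmax) t := by
    intro x
    by_cases hx : x ∈ closedBall x₀ r
    · obtain ⟨α, hα⟩ := ODE.FunSpace.exists_isFixedPt_next hf hx
      refine ⟨α.compProj, fun _ ↦ ⟨?_, fun t ht ↦ ⟨α.compProj_mem_closedBall hf.mul_max_le, ?_⟩⟩⟩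
      · rw [ODE.FunSpace.compProj_val, ← hα, ODE.FunSpace.next_apply₀]
      · apply ODE.hasDerivWithinAt_picard_Icc t₀.2 hf.continuousOn_uncurry
          α.continuous_compProj.continuousOn
          (fun _ ht' ↦ α.compProj_mem_closedBall hf.mul_max_le) x ht |>.congr_of_mem _ ht
        intro t' ht'
        nth_rw 1 [← hα]
        rw [ODE.FunSpace.compProj_of_mem ht', ODE.FunSpace.next_apply]
    · exact ⟨0, fun h ↦ absurd h hx⟩
  choose α hα using key
  exact ⟨α, hα⟩

variable {E : Type*} [NormedAddCommGroup E] [NormedSpace ℂ E]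

theorem norm_smul_sub_smul_le (c d : ℂ) (v w : E) :
    ‖c • v - d • w‖ ≤ ‖c - d‖ * ‖v‖ + ‖d‖ * ‖v - w‖ := by
  have : c • v - d • w = (c - d) • v + d • (v - w) := by module
  rw [this, ← norm_smul, ← norm_smul]
  exact norm_add_le _ _

/-- The complex-time flow, along real segments issued from `t₀`, of a Lipschitz vector field that
vanishes along `z = 0`. -/
theorem exists_flow_of_lipschitzOnWith [CompleteSpace E] {V : ℂ × E → E} {t₀ : ℂ} {K : ℝ≥0}
    {U : Set (ℂ × E)} (hU : U ∈ 𝓝 (t₀, (0 : E))) (hV : LipschitzOnWith K V U)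
    (hV0 : ∀ t, V (t, 0) = 0) :
    ∃ T ∈ 𝓝 t₀, ∃ r : ℝ, 0 < r ∧ ∃ H : ℂ × E → E,
      ContinuousOn H (T ×ˢ ball (0 : E) r) ∧ ∀ t ∈ T, H (t, 0) = 0 ∧
        (∀ p ∈ ball (0 : E) r, ∀ q ∈ ball (0 : E) r,
          ‖H (t, p) - H (t, q) - (p - q)‖ ≤ 1 / 2 * ‖p - q‖) ∧
        ∀ p ∈ ball (0 : E) r, ∃ γ : ℝ → E, γ 0 = p ∧ γ 1 = H (t, p) ∧
          ∀ τ ∈ Icc (0 : ℝ) 1, (t₀ + τ * (t - t₀), γ τ) ∈ U ∧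
            HasDerivWithinAt γ ((t - t₀) • V (t₀ + τ * (t - t₀), γ τ)) (Icc 0 1) τ := by
  obtain ⟨ρ, hρ, hρU⟩ := nhds_basis_closedBall.mem_iff.1 hU
  obtain ⟨a, ha, haρ, haK⟩ : ∃ a : ℝ, 0 < a ∧ a ≤ ρ ∧ K * a ≤ 1 / 8 := by
    refine ⟨min ρ (1 / (8 * (K + 1))), by positivity, min_le_left _ _, ?_⟩
    calc (K : ℝ) * min ρ (1 / (8 * (K + 1))) ≤ (K + 1) * (1 / (8 * (K + 1))) := by
          gcongr
          · linarith
          · exact min_le_right _ _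
      _ = 1 / 8 := by field_simp
  have mem {τ : ℝ} (hτ : τ ∈ Icc (0 : ℝ) 1) {d : ℂ} (hd : ‖d‖ ≤ a) {z : E} (hz : ‖z‖ ≤ a) :
      (t₀ + τ * d, z) ∈ U := by
    refine hρU ?_
    rw [mem_closedBall, dist_eq_norm, Prod.mk_sub_mk, add_sub_cancel_left, sub_zero, Prod.norm_mk]
    refine max_le ?_ (hz.trans haρ)
    rw [norm_mul, Complex.norm_real, Real.norm_of_nonneg hτ.1]
    nlinarith [hτ.1, hτ.2, norm_nonneg d]
  have Vnorm {τ : ℝ} (hτ : τ ∈ Icc (0 : ℝ) 1) {d : ℂ} (hd : ‖d‖ ≤ a) {z : E} (hz : ‖z‖ ≤ a) :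
      ‖V (t₀ + τ * d, z)‖ ≤ 1 / 8 := by
    have h := hV.norm_sub_le (mem hτ hd hz) (mem hτ hd (z := 0) (by simpa using ha.le))
    rw [hV0, sub_zero, Prod.mk_sub_mk, sub_self, sub_zero, Prod.norm_mk, norm_zero,
      max_eq_right (norm_nonneg z)] at h
    exact h.trans ((mul_le_mul_of_nonneg_left hz K.2).trans haK)
  let v : ℝ → ℂ × E → ℂ × E := fun τ w ↦ (0, w.1 • V (t₀ + τ * w.1, w.2))
  have hball {w : ℂ × E} : w ∈ closedBall (0 : ℂ × E) a ↔ ‖w.1‖ ≤ a ∧ ‖w.2‖ ≤ a := by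
    rw [mem_closedBall_zero_iff, Prod.norm_def, max_le_iff]
  have vlip : ∀ τ ∈ Icc (0 : ℝ) 1, LipschitzOnWith 1 (v τ) (closedBall 0 a) := by
    intro τ hτ
    refine lipschitzOnWith_iff_norm_sub_le.2 fun w hw w' hw' ↦ ?_
    obtain ⟨h1, h2⟩ := hball.1 hw
    obtain ⟨h1', h2'⟩ := hball.1 hw'
    simp only [v, Prod.mk_sub_mk, sub_self, Prod.norm_mk, norm_zero, NNReal.coe_one, one_mul]
    refine max_le (norm_nonneg _) ((norm_smul_sub_smul_le _ _ _ _).trans ?_)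
    have hVd := hV.norm_sub_le (mem hτ h1 h2) (mem hτ h1' h2')
    have hle : ‖(t₀ + τ * w.1, w.2) - (t₀ + τ * w'.1, w'.2)‖ ≤ ‖w - w'‖ := by
      rw [Prod.mk_sub_mk, Prod.norm_mk, add_sub_add_left_eq_sub, ← mul_sub, norm_mul,
        Complex.norm_real, Real.norm_of_nonneg hτ.1, Prod.norm_def (w - w')]
      refine max_le_max ?_ le_rfl
      exact mul_le_of_le_one_left (norm_nonneg _) hτ.2
    have hfst : ‖w.1 - w'.1‖ ≤ ‖w - w'‖ := norm_fst_le (w - w')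
    calc ‖w.1 - w'.1‖ * ‖V (t₀ + τ * w.1, w.2)‖
          + ‖w'.1‖ * ‖V (t₀ + τ * w.1, w.2) - V (t₀ + τ * w'.1, w'.2)‖
        ≤ ‖w - w'‖ * (1 / 8) + a * (K * ‖w - w'‖) := by
          gcongr
          · exact Vnorm hτ h1 h2
          · exact hVd.trans (by gcongr)
      _ = (1 / 8 + K * a) * ‖w - w'‖ := by ring
      _ ≤ 1 * ‖w - w'‖ := by gcongr; linarith
      _ = ‖w - w'‖ := one_mul _
  have hpl : IsPicardLindelof v (⟨0, by simp⟩ : Icc (0 : ℝ) 1) (0 : ℂ × E) ⟨a, ha.le⟩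
      ⟨a / 2, by positivity⟩ ⟨a / 2, by positivity⟩ 1 := by
    refine ⟨vlip, fun w hw ↦ ?_, fun τ hτ w hw ↦ ?_, ?_⟩
    · obtain ⟨h1, h2⟩ := hball.1 hw
      refine continuousOn_const.prodMk (continuousOn_const.smul ?_)
      exact hV.continuousOn.comp (by fun_prop) fun τ hτ ↦ mem hτ h1 h2
    · obtain ⟨h1, h2⟩ := hball.1 hw
      simp only [v, Prod.norm_mk, norm_zero, norm_smul]
      refine max_le (half_pos ha).le ?_
      have := Vnorm hτ h1 h2
      change _ ≤ a / 2
      nlinarith [norm_nonneg w.1, norm_nonneg (V (t₀ + τ * w.1, w.2))]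
    · change a / 2 * max (1 - 0) (0 - 0) ≤ a - a / 2
      norm_num
      linarith
  obtain ⟨α, hα⟩ := hpl.exists_forall_mem_closedBall
  have hα' : ∀ w : ℂ × E, ‖w‖ ≤ a / 2 → α w 0 = w ∧ ∀ t ∈ Icc (0 : ℝ) 1,
      α w t ∈ closedBall 0 a ∧ HasDerivWithinAt (α w) (v t (α w t)) (Icc 0 1) t :=
    fun w hw ↦ hα w (mem_closedBall_zero_iff.2 hw)
  have hexp : Real.exp 1 ≤ 4 := by linarith [Real.exp_one_lt_d9]
  have hright {w : ℂ × E} (hw : ‖w‖ ≤ a / 2) :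
      ∀ τ ∈ Ico (0 : ℝ) 1, HasDerivWithinAt (α w) (v τ (α w τ)) (Ici τ) τ := fun τ hτ ↦
    ((hα' w hw).2 τ (Ico_subset_Icc_self hτ)).2.mono_of_mem_nhdsWithin (Icc_mem_nhdsGE_of_mem hτ)
  have hcont {w : ℂ × E} (hw : ‖w‖ ≤ a / 2) : ContinuousOn (α w) (Icc 0 1) :=
    fun τ hτ ↦ ((hα' w hw).2 τ hτ).2.continuousWithinAt
  have hsnd {w : ℂ × E} (hw : ‖w‖ ≤ a / 2) {τ : ℝ} (hτ : τ ∈ Icc (0 : ℝ) 1) :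
      HasDerivWithinAt (fun τ ↦ (α w τ).2) (v τ (α w τ)).2 (Icc 0 1) τ :=
    (ContinuousLinearMap.snd ℝ ℂ E).hasFDerivAt.comp_hasDerivWithinAt τ ((hα' w hw).2 τ hτ).2
  have αlip {w w' : ℂ × E} (hw : ‖w‖ ≤ a / 2) (hw' : ‖w'‖ ≤ a / 2) {τ : ℝ}
      (hτ : τ ∈ Icc (0 : ℝ) 1) : ‖α w τ - α w' τ‖ ≤ 4 * ‖w - w'‖ := by
    have := dist_le_of_trajectories_ODE_of_mem (v := v) (s := fun _ ↦ closedBall 0 a)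
      (fun t ht ↦ vlip t (Ico_subset_Icc_self ht)) (hcont hw) (hright hw)
      (fun t ht ↦ ((hα' w hw).2 t (Ico_subset_Icc_self ht)).1) (hcont hw') (hright hw')
      (fun t ht ↦ ((hα' w' hw').2 t (Ico_subset_Icc_self ht)).1) le_rfl τ hτ
    rw [(hα' w hw).1, (hα' w' hw').1, dist_eq_norm, dist_eq_norm] at this
    refine this.trans ?_
    rw [mul_comm]
    gcongr
    refine (Real.exp_le_exp.2 ?_).trans hexp
    simpa using hτ.2
  have αfst {w : ℂ × E} (hw : ‖w‖ ≤ a / 2) {τ : ℝ} (hτ : τ ∈ Icc (0 : ℝ) 1) :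
      (α w τ).1 = w.1 := by
    have := constant_of_has_deriv_right_zero (f := fun τ ↦ (α w τ).1) (a := 0) (b := 1)
      (continuous_fst.comp_continuousOn (hcont hw)) (fun τ hτ ↦ (hright hw τ hτ).fst) τ hτ
    simpa only [(hα' w hw).1] using this
  have αzero {d : ℂ} (hd : ‖d‖ ≤ a / 2) : α (d, 0) 1 = (d, 0) := by
    have hw : ‖(d, (0 : E))‖ ≤ a / 2 := max_le hd (by simpa using (half_pos ha).le)
    have h0 : (0 : ℝ) ∈ Icc (0 : ℝ) 1 := by simp
    have := dist_le_of_trajectories_ODE_of_mem (v := v) (s := fun _ ↦ closedBall 0 a)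
      (fun t ht ↦ vlip t (Ico_subset_Icc_self ht)) (hcont hw) (hright hw)
      (fun t ht ↦ ((hα' _ hw).2 t (Ico_subset_Icc_self ht)).1)
      (g := fun _ ↦ (d, (0 : E))) continuousOn_const
      (fun t ht ↦ by
        simpa [v, hV0, ← Prod.zero_eq_mk] using hasDerivWithinAt_const t (Ici t) (d, (0 : E)))
      (fun t ht ↦ hball.2 ⟨by linarith, by simpa using ha.le⟩) le_rfl 1 (by simp)
    rw [(hα' _ hw).1, dist_self, zero_mul] at this
    exact dist_le_zero.1 this
  have hnorm {t : ℂ} (ht : t ∈ ball t₀ (a / 2)) {p : E} (hp : p ∈ ball (0 : E) (a / 2)) :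
      ‖(t - t₀, p)‖ ≤ a / 2 := by
    rw [mem_ball_iff_norm] at ht
    rw [mem_ball_zero_iff] at hp
    exact max_le ht.le hp.le
  refine ⟨ball t₀ (a / 2), ball_mem_nhds _ (by positivity), a / 2, by positivity,
    fun w ↦ (α (w.1 - t₀, w.2) 1).2, ?_, fun t ht ↦ ⟨?_, fun p hp q hq ↦ ?_, fun p hp ↦ ?_⟩⟩
  · refine LipschitzOnWith.continuousOn (K := 4) (lipschitzOnWith_iff_norm_sub_le.2 ?_)
    rintro ⟨t, p⟩ ⟨ht, hp⟩ ⟨t', p'⟩ ⟨ht', hp'⟩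
    have := αlip (hnorm ht hp) (hnorm ht' hp') (τ := 1) (by simp)
    have hsub : (t - t₀, p) - (t' - t₀, p') = (t, p) - (t', p') := by simp
    rw [← hsub]
    exact (norm_snd_le _).trans this
  · change (α (t - t₀, 0) 1).2 = 0
    rw [αzero (mem_ball_iff_norm.1 ht).le]
  · set w := (t - t₀, p)
    set w' := (t - t₀, q)
    have hw : ‖w‖ ≤ a / 2 := hnorm ht hp
    have hw' : ‖w'‖ ≤ a / 2 := hnorm ht hq
    have hww : ‖w - w'‖ = ‖p - q‖ := by simp [w, w']
    have h01 := norm_image_sub_le_of_norm_deriv_le_segment_01'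
      (f := fun τ ↦ (α w τ).2 - (α w' τ).2) (C := 1 / 2 * ‖p - q‖)
      (fun τ hτ ↦ (hsnd hw hτ).sub (hsnd hw' hτ)) ?_
    · simpa only [(hα' w hw).1, (hα' w' hw').1] using h01
    · intro τ hτ
      have hτ' := Ico_subset_Icc_self hτ
      obtain ⟨h1, h2⟩ := hball.1 ((hα' w hw).2 τ hτ').1
      obtain ⟨h1', h2'⟩ := hball.1 ((hα' w' hw').2 τ hτ').1
      have hVd := hV.norm_sub_le (mem hτ' h1 h2) (mem hτ' h1' h2')
      have hl := αlip hw hw' hτ'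
      rw [hww] at hl
      simp only [v]
      rw [αfst hw hτ'] at hVd h1 ⊢
      rw [αfst hw' hτ'] at hVd ⊢
      change ‖(t - t₀) • _ - (t - t₀) • _‖ ≤ _
      rw [← smul_sub, norm_smul]
      change ‖t - t₀‖ ≤ a at h1
      rw [Prod.mk_sub_mk] at hVd
      simp only [w, w', sub_self, Prod.norm_mk, norm_zero, max_eq_right (norm_nonneg _)] at hVd
      have hs := norm_snd_le (α w τ - α w' τ)
      rw [Prod.snd_sub] at hs
      calc _ ≤ a * (K * (4 * ‖p - q‖)) := by
            gcongr
            exact hVd.trans (by gcongr; exact hs.trans hl)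
        _ = (K * a) * (4 * ‖p - q‖) := by ring
        _ ≤ 1 / 8 * (4 * ‖p - q‖) := by gcongr
        _ = 1 / 2 * ‖p - q‖ := by ring
  · have hw := hnorm ht hp
    refine ⟨fun τ ↦ (α (t - t₀, p) τ).2, by simp [(hα' _ hw).1], rfl, fun τ hτ ↦ ?_⟩
    obtain ⟨h1, h2⟩ := hball.1 ((hα' _ hw).2 τ hτ).1
    have hd' := hsnd hw hτ
    simp only [v] at hd'
    rw [αfst hw hτ] at hd' h1
    exact ⟨mem hτ h1 h2, hd'⟩

end Flow

section Quotients

/-- The estimates satisfied by a product of `k + 1` factors, each equal to `x` or `conj x`. -/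
structure IsMonomialLike (P : ℂ → ℂ) (k : ℕ) : Prop where
  norm_le : ∀ x, ‖P x‖ ≤ ‖x‖ ^ (k + 1)
  norm_sub_le : ∀ R x x', ‖x‖ ≤ R → ‖x'‖ ≤ R → ‖P x - P x'‖ ≤ (k + 1) * R ^ k * ‖x - x'‖

namespace IsMonomialLike

theorem id : IsMonomialLike (fun x ↦ x) 0 :=
  ⟨by simp, by simp⟩

theorem star : IsMonomialLike (fun x ↦ conj x) 0 :=
  ⟨by simp, fun R x x' _ _ ↦ by rw [← map_sub, RCLike.norm_conj]; simp⟩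

theorem mul {P Q : ℂ → ℂ} {k l : ℕ} (hP : IsMonomialLike P k) (hQ : IsMonomialLike Q l) :
    IsMonomialLike (fun x ↦ P x * Q x) (k + l + 1) := by
  refine ⟨fun x ↦ ?_, fun R x x' hx hx' ↦ ?_⟩
  · rw [norm_mul]
    calc ‖P x‖ * ‖Q x‖ ≤ ‖x‖ ^ (k + 1) * ‖x‖ ^ (l + 1) := by
          gcongr
          exacts [hP.norm_le x, hQ.norm_le x]
      _ = ‖x‖ ^ (k + l + 1 + 1) := by ring
  · have hR : 0 ≤ R := (norm_nonneg x).trans hx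
    calc ‖P x * Q x - P x' * Q x'‖ ≤ ‖P x - P x'‖ * ‖Q x‖ + ‖P x'‖ * ‖Q x - Q x'‖ := by
          rw [← norm_mul, ← norm_mul]
          exact (congrArg norm (by ring)).le.trans (norm_add_le _ _)
      _ ≤ ((k + 1) * R ^ k * ‖x - x'‖) * R ^ (l + 1)
          + R ^ (k + 1) * ((l + 1) * R ^ l * ‖x - x'‖) := by
          gcongr
          · exact hP.norm_sub_le R x x' hx hx'
          · exact (hQ.norm_le x).trans (by gcongr)
          · exact (hP.norm_le x').trans (by gcongr)
          · exact hQ.norm_sub_le R x x' hx hx'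
      _ = ((k + l + 1 : ℕ) + 1) * R ^ (k + l + 1) * ‖x - x'‖ := by push_cast; ring

end IsMonomialLike

theorem norm_div_sub_div_le_s14 {N N' : ℂ} {d d' c c' δ : ℝ} (hd : 0 < d) (hd' : 0 < d')
    (hN : ‖N - N'‖ ≤ c * δ * d) (hN' : ‖N'‖ * |d - d'| ≤ c' * δ * (d' * d)) :
    ‖N / (d : ℂ) - N' / (d' : ℂ)‖ ≤ (c + c') * δ := by
  have hdc : (d : ℂ) ≠ 0 := by exact_mod_cast hd.ne'
  have hdc' : (d' : ℂ) ≠ 0 := by exact_mod_cast hd'.ne'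
  have hsplit : N / (d : ℂ) - N' / (d' : ℂ)
      = (N - N') / d - N' * ((d - d' : ℝ) : ℂ) / ((d' * d : ℝ) : ℂ) := by
    push_cast
    field_simp
    ring
  rw [hsplit]
  refine (norm_sub_le _ _).trans ?_
  rw [norm_div, norm_div, norm_mul, Complex.norm_real, Complex.norm_real, Complex.norm_real,
    Real.norm_of_nonneg hd.le, Real.norm_of_nonneg (mul_pos hd' hd).le, Real.norm_eq_abs, add_mul]
  exact add_le_add ((div_le_iff₀ hd).2 hN) ((div_le_iff₀ (mul_pos hd' hd)).2 hN')

theorem IsMonomialLike.norm_div_sub_div_le {P : ℂ → ℂ} {k n : ℕ} (hP : IsMonomialLike P k)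
    {A : ℂ} {C w : ℝ} (hA : ‖A‖ ≤ C) (hw : 0 < w)
    (h₁ : ∀ u : ℝ, 0 ≤ u → u ≤ 1 → u ^ k * C ≤ u ^ (n + 1) + w)
    (h₂ : ∀ u v : ℝ, 0 ≤ v → v ≤ u → u ≤ 1 →
      v ^ (k + 1) * C * u ^ n ≤ (v ^ (n + 1) + w) * (u ^ (n + 1) + w))
    {x x' : ℂ} (hx : ‖x‖ ≤ 1) (hx' : ‖x'‖ ≤ 1) :
    ‖P x * A / ((‖x‖ ^ (n + 1) + w : ℝ) : ℂ) - P x' * A / ((‖x'‖ ^ (n + 1) + w : ℝ) : ℂ)‖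
      ≤ ((k + 1) + (n + 1)) * ‖x - x'‖ := by
  wlog hle : ‖x'‖ ≤ ‖x‖ generalizing x x'
  · rw [norm_sub_rev, norm_sub_rev x]
    exact this hx' hx (not_le.1 hle).le
  have hC : 0 ≤ C := (norm_nonneg A).trans hA
  refine _root_.norm_div_sub_div_le_s14 (by positivity) (by positivity) ?_ ?_
  · rw [← sub_mul, norm_mul]
    calc ‖P x - P x'‖ * ‖A‖ ≤ ((k + 1) * ‖x‖ ^ k * ‖x - x'‖) * C := by
          gcongr
          exact hP.norm_sub_le _ x x' le_rfl hle
      _ = (k + 1) * ‖x - x'‖ * (‖x‖ ^ k * C) := by ring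
      _ ≤ _ := by
          gcongr
          exact h₁ _ (norm_nonneg x) hx
  · have hpow := abs_pow_sub_pow_le ‖x‖ ‖x'‖ (n + 1)
    rw [abs_norm, abs_norm, max_eq_left hle, Nat.add_sub_cancel] at hpow
    rw [norm_mul, add_sub_add_right_eq_sub]
    calc ‖P x'‖ * ‖A‖ * |‖x‖ ^ (n + 1) - ‖x'‖ ^ (n + 1)|
        ≤ ‖x'‖ ^ (k + 1) * C * (‖x - x'‖ * (n + 1 : ℕ) * ‖x‖ ^ n) := by
          gcongr
          · exact hP.norm_le x'
          · refine hpow.trans ?_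
            gcongr
            exact abs_norm_sub_norm_le x x'
      _ = (n + 1) * ‖x - x'‖ * (‖x'‖ ^ (k + 1) * C * ‖x‖ ^ n) := by push_cast; ring
      _ ≤ _ := by
          refine mul_le_mul_of_nonneg_left ?_ (by positivity)
          exact h₂ _ _ (norm_nonneg x') hle hx

/-- The weighted denominator `‖x‖ ^ 4 + ‖y‖ ^ 6`. -/
noncomputable def weightedDenom (z : ℂ × ℂ) : ℝ := ‖z.1‖ ^ 4 + ‖z.2‖ ^ 6

theorem IsMonomialLike.lipschitzOnWith_div_weightedDenom {P Q : ℂ → ℂ} {k l : ℕ}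
    (hP : IsMonomialLike P k) (hQ : IsMonomialLike Q l)
    (h₁ : ∀ u w : ℝ, 0 ≤ u → u ≤ 1 → 0 ≤ w → w ≤ 1 → u ^ k * w ^ (l + 1) ≤ u ^ 4 + w ^ 6)
    (h₂ : ∀ u v w : ℝ, 0 ≤ v → v ≤ u → u ≤ 1 → 0 ≤ w → w ≤ 1 →
      v ^ (k + 1) * w ^ (l + 1) * u ^ 3 ≤ (v ^ 4 + w ^ 6) * (u ^ 4 + w ^ 6))
    (h₃ : ∀ u w : ℝ, 0 ≤ u → u ≤ 1 → 0 ≤ w → w ≤ 1 → w ^ l * u ^ (k + 1) ≤ w ^ 6 + u ^ 4)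
    (h₄ : ∀ u v w : ℝ, 0 ≤ v → v ≤ w → w ≤ 1 → 0 ≤ u → u ≤ 1 →
      v ^ (l + 1) * u ^ (k + 1) * w ^ 5 ≤ (v ^ 6 + u ^ 4) * (w ^ 6 + u ^ 4)) :
    LipschitzOnWith (k + l + 12) (fun z : ℂ × ℂ ↦ P z.1 * Q z.2 / (weightedDenom z : ℂ))
      (closedBall 0 1) := by
  have hP0 : P 0 = 0 := by simpa using hP.norm_le 0
  have hQ0 : Q 0 = 0 := by simpa using hQ.norm_le 0
  refine lipschitzOnWith_iff_norm_sub_le.2 ?_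
  rintro ⟨x, y⟩ hz ⟨x', y'⟩ hz'
  obtain ⟨hx, hy⟩ := max_le_iff.1 (mem_closedBall_zero_iff.1 hz)
  obtain ⟨hx', hy'⟩ := max_le_iff.1 (mem_closedBall_zero_iff.1 hz')
  change ‖x‖ ≤ 1 at hx
  change ‖y‖ ≤ 1 at hy
  change ‖x'‖ ≤ 1 at hx'
  change ‖y'‖ ≤ 1 at hy'
  have hfirst : ‖P x * Q y / (weightedDenom (x, y) : ℂ)
      - P x' * Q y / (weightedDenom (x', y) : ℂ)‖ ≤ ((k + 1) + ((3 : ℕ) + 1)) * ‖x - x'‖ := by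
    rcases eq_or_ne y 0 with rfl | hne
    · simp only [hQ0, mul_zero, zero_div, sub_self, norm_zero]
      positivity
    · have hpos : 0 < ‖y‖ ^ 6 := by positivity
      exact hP.norm_div_sub_div_le (n := 3) (hQ.norm_le y) hpos
        (fun u hu hu' ↦ h₁ u _ hu hu' (norm_nonneg y) hy)
        (fun u v hv hvu hu ↦ h₂ u v _ hv hvu hu (norm_nonneg y) hy) hx hx'
  have hsecond : ‖P x' * Q y / (weightedDenom (x', y) : ℂ)
      - P x' * Q y' / (weightedDenom (x', y') : ℂ)‖ ≤ ((l + 1) + ((5 : ℕ) + 1)) * ‖y - y'‖ := by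
    rcases eq_or_ne x' 0 with rfl | hne
    · simp only [hP0, zero_mul, zero_div, sub_self, norm_zero]
      positivity
    · have hpos : 0 < ‖x'‖ ^ 4 := by positivity
      simp only [weightedDenom, mul_comm (P x'), add_comm (‖x'‖ ^ 4)]
      exact hQ.norm_div_sub_div_le (n := 5) (hP.norm_le x') hpos
        (fun w hw hw' ↦ h₃ _ w (norm_nonneg x') hx' hw hw')
        (fun w v hv hvw hw ↦ h₄ _ v w hv hvw hw (norm_nonneg x') hx') hy hy'
  have hfst : ‖x - x'‖ ≤ ‖(x, y) - (x', y')‖ := norm_fst_le ((x, y) - (x', y'))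
  have hsnd : ‖y - y'‖ ≤ ‖(x, y) - (x', y')‖ := norm_snd_le ((x, y) - (x', y'))
  calc _ ≤ _ + _ := norm_sub_le_norm_sub_add_norm_sub _ _ _
    _ ≤ ((k + 1) + ((3 : ℕ) + 1)) * ‖x - x'‖ + ((l + 1) + ((5 : ℕ) + 1)) * ‖y - y'‖ :=
        add_le_add hfirst hsecond
    _ ≤ ((k + 1) + ((3 : ℕ) + 1)) * ‖(x, y) - (x', y')‖
        + ((l + 1) + ((5 : ℕ) + 1)) * ‖(x, y) - (x', y')‖ := by gcongr
    _ = _ := by push_cast; ring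

theorem sq_mul_cube_le_add (u w : ℝ) : u ^ 2 * w ^ 3 ≤ u ^ 4 + w ^ 6 := by
  nlinarith [sq_nonneg (u ^ 2 - w ^ 3), sq_nonneg (u ^ 2), sq_nonneg (w ^ 3)]

theorem cube_mul_sq_le_add {u w : ℝ} (hu : 0 ≤ u) (hw : 0 ≤ w) (hw' : w ≤ 1) :
    u ^ 3 * w ^ 2 ≤ u ^ 4 + w ^ 6 := by
  rcases le_total u (w ^ 2) with h | h
  · calc u ^ 3 * w ^ 2 ≤ (w ^ 2) ^ 3 * 1 := by
          gcongr
          exact pow_le_one₀ hw hw'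
      _ ≤ u ^ 4 + w ^ 6 := by nlinarith [pow_nonneg hu 4]
  · nlinarith [pow_nonneg hu 3, pow_nonneg hw 6, mul_le_mul_of_nonneg_left h (pow_nonneg hu 3)]

theorem mul_mul_cube_le_add {u v w : ℝ} (hv : 0 ≤ v) (hvu : v ≤ u) (hw : 0 ≤ w) (hw' : w ≤ 1) :
    v * w * u ^ 3 ≤ u ^ 4 + w ^ 6 := by
  have hu := hv.trans hvu
  calc v * w * u ^ 3 ≤ u * 1 * u ^ 3 := by gcongr
    _ ≤ u ^ 4 + w ^ 6 := by nlinarith [pow_nonneg hw 6]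

theorem mul_mul_pow_five_le_add {u v w : ℝ} (hv : 0 ≤ v) (hvw : v ≤ w) (hu : 0 ≤ u)
    (hu' : u ≤ 1) : u * v * w ^ 5 ≤ w ^ 6 + u ^ 4 := by
  have hw := hv.trans hvw
  calc u * v * w ^ 5 ≤ 1 * w * w ^ 5 := by gcongr
    _ ≤ w ^ 6 + u ^ 4 := by nlinarith [pow_nonneg hu 4]

theorem sq_mul_pow_five_le_add {u v w : ℝ} (hv : 0 ≤ v) (hvw : v ≤ w) (hw' : w ≤ 1) :
    v ^ 2 * w ^ 5 ≤ w ^ 6 + u ^ 4 := by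
  have hw := hv.trans hvw
  calc v ^ 2 * w ^ 5 ≤ w ^ 2 * w ^ 5 := by gcongr
    _ = w ^ 6 * w := by ring
    _ ≤ w ^ 6 * 1 := by gcongr
    _ ≤ w ^ 6 + u ^ 4 := by nlinarith [sq_nonneg (u ^ 2)]

theorem lipschitzOnWith_x_sq_conj_x_sq_y_sq :
    LipschitzOnWith 16 (fun z : ℂ × ℂ ↦
      z.1 * z.1 * (conj z.1 * conj z.1) * (z.2 * z.2) / (weightedDenom z : ℂ))
      (closedBall 0 1) := by
  have hP := (IsMonomialLike.id.mul .id).mul (IsMonomialLike.star.mul .star)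
  have hQ := IsMonomialLike.id.mul .id
  refine (hP.lipschitzOnWith_div_weightedDenom hQ ?_ ?_ ?_ ?_).weaken (by norm_num)
  · intro u w hu hu' hw hw'
    exact cube_mul_sq_le_add hu hw hw'
  · intro u v w hv hvu hu hw hw'
    have hu0 := hv.trans hvu
    calc v ^ 4 * w ^ 2 * u ^ 3 = v ^ 4 * (u ^ 3 * w ^ 2) := by ring
      _ ≤ _ := mul_le_mul (le_add_of_nonneg_right (by positivity))
        (cube_mul_sq_le_add hu0 hw hw') (by positivity) (by positivity)
  · intro u w hu hu' hw hw'
    norm_num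
    nlinarith [pow_nonneg hw 6, pow_nonneg hu 4]
  · intro u v w hv hvw hw hu hu'
    have hw0 := hv.trans hvw
    calc v ^ 2 * u ^ 4 * w ^ 5 = u ^ 4 * (v ^ 2 * w ^ 5) := by ring
      _ ≤ _ := mul_le_mul (le_add_of_nonneg_left (by positivity))
        (sq_mul_pow_five_le_add hv hvw hw) (by positivity) (by positivity)

theorem lipschitzOnWith_x_conj_x_sq_y_pow_four :
    LipschitzOnWith 17 (fun z : ℂ × ℂ ↦
      z.1 * (conj z.1 * conj z.1) * (z.2 * z.2 * (z.2 * z.2)) / (weightedDenom z : ℂ))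
      (closedBall 0 1) := by
  have hP := IsMonomialLike.id.mul (IsMonomialLike.star.mul .star)
  have hQ := (IsMonomialLike.id.mul .id).mul (IsMonomialLike.id.mul .id)
  refine (hP.lipschitzOnWith_div_weightedDenom hQ ?_ ?_ ?_ ?_).weaken (by norm_num)
  · intro u w hu hu' hw hw'
    calc u ^ 2 * w ^ 4 = u ^ 2 * w ^ 3 * w := by ring
      _ ≤ u ^ 2 * w ^ 3 * 1 := by gcongr
      _ ≤ _ := by rw [mul_one]; exact sq_mul_cube_le_add u w
  · intro u v w hv hvu hu hw hw'
    have hu0 := hv.trans hvu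
    calc v ^ 3 * w ^ 4 * u ^ 3 = v ^ 2 * w ^ 3 * (v * w * u ^ 3) := by ring
      _ ≤ _ := mul_le_mul (sq_mul_cube_le_add v w)
        (mul_mul_cube_le_add hv hvu hw hw') (by positivity) (by positivity)
  · intro u w hu hu' hw hw'
    calc w ^ 3 * u ^ 3 = u ^ 2 * w ^ 3 * u := by ring
      _ ≤ u ^ 2 * w ^ 3 * 1 := by gcongr
      _ ≤ _ := by rw [mul_one, add_comm]; exact sq_mul_cube_le_add u w
  · intro u v w hv hvw hw hu hu'
    have hw0 := hv.trans hvw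
    calc v ^ 4 * u ^ 3 * w ^ 5 = u ^ 2 * v ^ 3 * (u * v * w ^ 5) := by ring
      _ ≤ _ := mul_le_mul ((sq_mul_cube_le_add u v).trans_eq (add_comm _ _))
        (mul_mul_pow_five_le_add hv hvw hu hu') (by positivity) (by positivity)

theorem lipschitzOnWith_x_y_pow_four_conj_y_cube :
    LipschitzOnWith 18 (fun z : ℂ × ℂ ↦
      z.1 * (z.2 * z.2 * (z.2 * z.2) * (conj z.2 * (conj z.2 * conj z.2))) / (weightedDenom z : ℂ))
      (closedBall 0 1) := by
  have hP := IsMonomialLike.id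
  have hQ := ((IsMonomialLike.id.mul .id).mul (IsMonomialLike.id.mul .id)).mul
    (IsMonomialLike.star.mul (IsMonomialLike.star.mul .star))
  refine (hP.lipschitzOnWith_div_weightedDenom hQ ?_ ?_ ?_ ?_).weaken (by norm_num)
  · intro u w hu hu' hw hw'
    calc u ^ 0 * w ^ 7 = w ^ 6 * w := by ring
      _ ≤ w ^ 6 * 1 := by gcongr
      _ ≤ _ := by nlinarith [pow_nonneg hu 4]
  · intro u v w hv hvu hu hw hw'
    have hu0 := hv.trans hvu
    calc v ^ 1 * w ^ 7 * u ^ 3 = w ^ 6 * (v * w * u ^ 3) := by ring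
      _ ≤ _ := mul_le_mul (le_add_of_nonneg_left (by positivity))
        (mul_mul_cube_le_add hv hvu hw hw') (by positivity) (by positivity)
  · intro u w hu hu' hw hw'
    calc w ^ 6 * u ^ 1 ≤ w ^ 6 * 1 := by rw [pow_one]; gcongr
      _ ≤ _ := by nlinarith [pow_nonneg hu 4]
  · intro u v w hv hvw hw hu hu'
    have hw0 := hv.trans hvw
    calc v ^ 7 * u ^ 1 * w ^ 5 = v ^ 6 * (u * v * w ^ 5) := by ring
      _ ≤ _ := mul_le_mul (le_add_of_nonneg_right (by positivity))
        (mul_mul_pow_five_le_add hv hvw hu hu') (by positivity) (by positivity)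

theorem lipschitzOnWith_x_sq_y_sq_conj_y_cube :
    LipschitzOnWith 17 (fun z : ℂ × ℂ ↦
      z.1 * z.1 * (z.2 * z.2 * (conj z.2 * (conj z.2 * conj z.2))) / (weightedDenom z : ℂ))
      (closedBall 0 1) := by
  have hP := IsMonomialLike.id.mul .id
  have hQ := (IsMonomialLike.id.mul .id).mul
    (IsMonomialLike.star.mul (IsMonomialLike.star.mul .star))
  refine (hP.lipschitzOnWith_div_weightedDenom hQ ?_ ?_ ?_ ?_).weaken (by norm_num)
  · intro u w hu hu' hw hw'
    calc u ^ 1 * w ^ 5 = 1 * u * w ^ 5 := by ring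
      _ ≤ u ^ 4 + w ^ 6 := by
        rcases le_total u w with h | h
        · rw [add_comm]
          calc 1 * u * w ^ 5 ≤ 1 * w * w ^ 5 := by gcongr
            _ ≤ _ := by nlinarith [pow_nonneg hu 4]
        · calc 1 * u * w ^ 5 = u * w ^ 3 * w ^ 2 := by ring
            _ ≤ u * u ^ 3 * 1 := by
              gcongr
              exact pow_le_one₀ hw hw'
            _ ≤ _ := by nlinarith [pow_nonneg hw 6]
  · intro u v w hv hvu hu hw hw'
    have hu0 := hv.trans hvu
    calc v ^ 2 * w ^ 5 * u ^ 3 = v ^ 2 * w ^ 3 * (u ^ 3 * w ^ 2) := by ring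
      _ ≤ _ := mul_le_mul (sq_mul_cube_le_add v w)
        (cube_mul_sq_le_add hu0 hw hw') (by positivity) (by positivity)
  · intro u w hu hu' hw hw'
    calc w ^ 4 * u ^ 2 = u ^ 2 * w ^ 3 * w := by ring
      _ ≤ u ^ 2 * w ^ 3 * 1 := by gcongr
      _ ≤ _ := by rw [mul_one, add_comm]; exact sq_mul_cube_le_add u w
  · intro u v w hv hvw hw hu hu'
    have hw0 := hv.trans hvw
    calc v ^ 5 * u ^ 2 * w ^ 5 = u ^ 2 * v ^ 3 * (v ^ 2 * w ^ 5) := by ring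
      _ ≤ _ := mul_le_mul ((sq_mul_cube_le_add u v).trans_eq (add_comm _ _))
        (sq_mul_pow_five_le_add hv hvw hw) (by positivity) (by positivity)

end Quotients

section LipschitzNear

variable {X : Type*} [PseudoMetricSpace X]

/-- `f` is Lipschitz on some neighborhood of `x`. -/
def IsLipschitzNear {Y : Type*} [PseudoMetricSpace Y] (f : X → Y) (x : X) : Prop :=
  ∃ K : ℝ≥0, ∃ U ∈ 𝓝 x, LipschitzOnWith K f U

namespace IsLipschitzNear

theorem prodMk {Y Z : Type*} [PseudoMetricSpace Y] [PseudoMetricSpace Z] {f : X → Y} {g : X → Z}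
    {x : X} (hf : IsLipschitzNear f x) (hg : IsLipschitzNear g x) :
    IsLipschitzNear (fun z ↦ (f z, g z)) x := by
  obtain ⟨K, U, hU, hf⟩ := hf
  obtain ⟨K', U', hU', hg⟩ := hg
  exact ⟨_, _, inter_mem hU hU', (hf.mono inter_subset_left).prodMk (hg.mono inter_subset_right)⟩

theorem sub {f g : X → ℂ} {x : X} (hf : IsLipschitzNear f x) (hg : IsLipschitzNear g x) :
    IsLipschitzNear (fun z ↦ f z - g z) x := by
  obtain ⟨K, U, hU, hf⟩ := hf
  obtain ⟨K', U', hU', hg⟩ := hg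
  exact ⟨_, _, inter_mem hU hU', (hf.mono inter_subset_left).sub (hg.mono inter_subset_right)⟩

theorem mul {f g : X → ℂ} {x : X} (hf : IsLipschitzNear f x) (hg : IsLipschitzNear g x) :
    IsLipschitzNear (fun z ↦ f z * g z) x := by
  obtain ⟨K, U, hU, hf⟩ := hf
  obtain ⟨K', U', hU', hg⟩ := hg
  have bound {f : X → ℂ} {U : Set X} {K : ℝ≥0} (hU : U ∈ 𝓝 x) (hf : LipschitzOnWith K f U) :
      ∀ᶠ z in 𝓝 x, ‖f z‖ ≤ ‖f x‖₊ + 1 :=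
    ((hf.continuousOn.continuousAt hU).norm.eventually_lt_const
      (lt_add_one ‖f x‖)).mono fun z hz ↦ hz.le
  refine ⟨K * (‖g x‖₊ + 1) + (‖f x‖₊ + 1) * K', _, inter_mem (inter_mem hU hU')
    (inter_mem (bound hU hf) (bound hU' hg)), lipschitzOnWith_iff_dist_le_mul.2 ?_⟩
  rintro z ⟨⟨hz, hz'⟩, -, hgz⟩ w ⟨⟨hw, hw'⟩, hfw, -⟩
  have h := hf.dist_le_mul z hz w hw
  have h' := hg.dist_le_mul z hz' w hw'
  rw [dist_eq_norm] at h h' ⊢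
  calc ‖f z * g z - f w * g w‖ ≤ ‖f z - f w‖ * ‖g z‖ + ‖f w‖ * ‖g z - g w‖ := by
        rw [← norm_mul, ← norm_mul]
        exact (congrArg norm (by ring)).le.trans (norm_add_le _ _)
    _ ≤ (K * dist z w) * (‖g x‖₊ + 1) + (‖f x‖₊ + 1) * (K' * dist z w) := by
        gcongr
        exacts [hgz, hfw]
    _ = _ := by push_cast; ring

end IsLipschitzNear

theorem LipschitzOnWith.isLipschitzNear_comp_snd {f : ℂ × ℂ → ℂ} {K : ℝ≥0}
    (hf : LipschitzOnWith K f (closedBall 0 1)) (t : ℂ) :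
    IsLipschitzNear (fun w : ℂ × (ℂ × ℂ) ↦ f w.2) (t, 0) := by
  refine ⟨K * 1, Prod.snd ⁻¹' closedBall 0 1, ?_,
    hf.comp LipschitzWith.prod_snd.lipschitzOnWith (mapsTo_preimage _ _)⟩
  exact continuous_snd.continuousAt.preimage_mem_nhds (closedBall_mem_nhds _ one_pos)

end LipschitzNear

section Field

variable (q : ℕ) (s : ℂ)

/-- The factor `2 + y ^ q (s + t y)`. -/
noncomputable def unitFactor (w : ℂ × (ℂ × ℂ)) : ℂ := 2 + w.2.2 ^ q * (s + w.1 * w.2.2)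

/-- The factor `(3 + q) s + (4 + q) t y` of the derivative of `y ^ (3 + q) (s + t y)`. -/
noncomputable def slopeFactor (w : ℂ × (ℂ × ℂ)) : ℂ := (3 + q) * s + (4 + q) * w.1 * w.2.2

/-- The denominator of the trivializing vector field, invertible near `y = 0`. -/
noncomputable def fieldDenom (w : ℂ × (ℂ × ℂ)) : ℂ :=
  unitFactor q s w * slopeFactor q s w + 6 * (s + w.1 * w.2.2)

/-- A Lipschitz vector field `V` in the variables `(x, y)` such that `∂ₜ + V` annihilates
`(x² + y³)² + s x² y ^ (3 + q) + t x² y ^ (4 + q)`. -/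
noncomputable def trivializingField (w : ℂ × (ℂ × ℂ)) : ℂ × ℂ :=
  ((fieldDenom q s w)⁻¹ *
    (3 * (w.2.1 * (conj w.2.1 * conj w.2.1) * (w.2.2 * w.2.2 * (w.2.2 * w.2.2)) /
        (weightedDenom w.2 : ℂ)) -
      (3 + w.2.2 ^ q * slopeFactor q s w / 2) *
        (w.2.1 * (w.2.2 * w.2.2 * (w.2.2 * w.2.2) * (conj w.2.2 * (conj w.2.2 * conj w.2.2))) /
          (weightedDenom w.2 : ℂ))),
  (fieldDenom q s w)⁻¹ *
    (2 * (w.2.1 * w.2.1 * (w.2.2 * w.2.2 * (conj w.2.2 * (conj w.2.2 * conj w.2.2))) /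
        (weightedDenom w.2 : ℂ)) -
      unitFactor q s w *
        (w.2.1 * w.2.1 * (conj w.2.1 * conj w.2.1) * (w.2.2 * w.2.2) / (weightedDenom w.2 : ℂ))))

variable {q s}

theorem trivializingField_zero (t : ℂ) : trivializingField q s (t, 0) = 0 := by
  simp [trivializingField]

theorem fieldDenom_ne_zero (hq : 1 ≤ q) (hs : s ≠ 0) (t : ℂ) : fieldDenom q s (t, 0) ≠ 0 := by
  have h : fieldDenom q s (t, 0) = ((12 + 2 * q : ℕ) : ℂ) * s := by
    simp [fieldDenom, unitFactor, slopeFactor, zero_pow (Nat.one_le_iff_ne_zero.1 hq)]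
    ring
  rw [h]
  exact mul_ne_zero (Nat.cast_ne_zero.2 (by omega)) hs

theorem contDiff_unitFactor : ContDiff ℂ 1 (unitFactor q s) := by
  unfold unitFactor
  fun_prop

theorem contDiff_slopeFactor : ContDiff ℂ 1 (slopeFactor q s) := by
  unfold slopeFactor
  fun_prop

theorem contDiff_fieldDenom : ContDiff ℂ 1 (fieldDenom q s) :=
  (contDiff_unitFactor.mul contDiff_slopeFactor).add (by fun_prop)

theorem isLipschitzNear_trivializingField (hq : 1 ≤ q) (hs : s ≠ 0) (t : ℂ) :
    IsLipschitzNear (trivializingField q s) (t, 0) := by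
  have near {f : ℂ × (ℂ × ℂ) → ℂ} (hf : ContDiffAt ℂ 1 f (t, 0)) : IsLipschitzNear f (t, 0) :=
    hf.exists_lipschitzOnWith
  have hinv : IsLipschitzNear (fun w ↦ (fieldDenom q s w)⁻¹) (t, 0) :=
    near (contDiff_fieldDenom.contDiffAt.inv (fieldDenom_ne_zero hq hs t))
  have hcoeff : IsLipschitzNear (fun w ↦ 3 + w.2.2 ^ q * slopeFactor q s w / 2) (t, 0) := by
    have := contDiff_slopeFactor (q := q) (s := s)
    exact near (ContDiff.contDiffAt (by fun_prop))
  exact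
    (hinv.mul (((near contDiffAt_const).mul
        (lipschitzOnWith_x_conj_x_sq_y_pow_four.isLipschitzNear_comp_snd t)).sub
      (hcoeff.mul (lipschitzOnWith_x_y_pow_four_conj_y_cube.isLipschitzNear_comp_snd t)))).prodMk
    (hinv.mul (((near contDiffAt_const).mul
        (lipschitzOnWith_x_sq_y_sq_conj_y_cube.isLipschitzNear_comp_snd t)).sub
      ((near contDiff_unitFactor.contDiffAt).mul
        (lipschitzOnWith_x_sq_conj_x_sq_y_sq.isLipschitzNear_comp_snd t))))

theorem weightedDenom_eq (z : ℂ × ℂ) :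
    (weightedDenom z : ℂ) = (z.1 * conj z.1) ^ 2 + (z.2 * conj z.2) ^ 3 := by
  rw [Complex.mul_conj', Complex.mul_conj', weightedDenom]
  push_cast
  ring

theorem trivializingField_annihilates {t x y : ℂ} (hQ : fieldDenom q s (t, (x, y)) ≠ 0) :
    x ^ 2 * y ^ (4 + q) +
      (trivializingField q s (t, (x, y))).1 *
        (4 * x * (x ^ 2 + y ^ 3) + 2 * x * y ^ (3 + q) * (s + t * y)) +
      (trivializingField q s (t, (x, y))).2 *
        (6 * y ^ 2 * (x ^ 2 + y ^ 3) + x ^ 2 * y ^ (2 + q) * slopeFactor q s (t, (x, y))) = 0 := by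
  by_cases hD : (weightedDenom (x, y) : ℂ) = 0
  · have hx : x = 0 := by
      have hD : ‖x‖ ^ 4 + ‖y‖ ^ 6 = 0 := by exact_mod_cast hD
      have : ‖x‖ ^ 4 = 0 := by
        nlinarith [pow_nonneg (norm_nonneg x) 4, pow_nonneg (norm_nonneg y) 6]
      simpa using this
    simp [trivializingField, hx]
  · have hD' := weightedDenom_eq (x, y)
    have hQ' : fieldDenom q s (t, (x, y)) = unitFactor q s (t, (x, y)) * slopeFactor q s (t, (x, y))
        + 6 * (s + t * y) := rfl
    have he : unitFactor q s (t, (x, y)) = 2 + y ^ q * (s + t * y) := rfl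
    simp only [trivializingField]
    generalize fieldDenom q s (t, (x, y)) = Q at *
    generalize (weightedDenom (x, y) : ℂ) = D at *
    generalize slopeFactor q s (t, (x, y)) = m at *
    generalize unitFactor q s (t, (x, y)) = e at *
    simp only [pow_add]
    dsimp only at hD' ⊢
    generalize conj x = x' at *
    generalize conj y = y' at *
    generalize y ^ q = g at *
    field_simp
    subst hQ' hD' he
    ring

end Field

section Family

variable {q : ℕ} {s : ℂ}

theorem hasDerivWithinAt_family {t x y : ℝ → ℂ} {t' x' y' : ℂ} {S : Set ℝ} {τ : ℝ}
    (ht : HasDerivWithinAt t t' S τ) (hx : HasDerivWithinAt x x' S τ)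
    (hy : HasDerivWithinAt y y' S τ) :
    HasDerivWithinAt (fun τ ↦ (x τ ^ 2 + y τ ^ 3) ^ 2 + s * x τ ^ 2 * y τ ^ (3 + q)
        + t τ * x τ ^ 2 * y τ ^ (4 + q))
      (t' * (x τ ^ 2 * y τ ^ (4 + q)) +
        x' * (4 * x τ * (x τ ^ 2 + y τ ^ 3) + 2 * x τ * y τ ^ (3 + q) * (s + t τ * y τ)) +
        y' * (6 * y τ ^ 2 * (x τ ^ 2 + y τ ^ 3)
          + x τ ^ 2 * y τ ^ (2 + q) * slopeFactor q s (t τ, (x τ, y τ)))) S τ := by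
  have h := ((((hx.pow 2).add (hy.pow 3)).pow 2).add
    (((hx.pow 2).const_mul s).mul (hy.pow (3 + q)))).add
      ((ht.mul (hx.pow 2)).mul (hy.pow (4 + q)))
  refine h.congr_deriv ?_
  have h3 : 3 + q - 1 = 2 + q := by omega
  have h4 : 4 + q - 1 = 3 + q := by omega
  simp only [h3, h4, slopeFactor, Pi.add_apply, Pi.pow_apply, Pi.mul_apply]
  push_cast
  ring

end Family

/-- The family Wsharp_even, `F t = fun (x,y) => (w.1 ^ 2 + w.2 ^ 3) ^ 2 + s * w.1 ^ 2 * w.2 ^ (3 + q) + τ * w.1 ^ 2 * w.2 ^ (4 + q)`, is Lipschitz trivial in `t` over `ℂ`: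
for every `t₀` there are a neighborhood `T` of `t₀`, `r > 0`, `L ≥ 1`, and a
continuous family `H` of bi-Lipschitz homeomorphisms with `F t ∘ H t = F t₀` on
`B(0,r)`. -/
theorem lipschitz_trivial_Wsharp_even (q : ℕ) (hq : 1 ≤ q) (s : ℂ) (hs : s ≠ 0) (t₀ : ℂ) :
    ∃ T ∈ nhds t₀, ∃ r L : ℝ, 0 < r ∧ 1 ≤ L ∧
      ∃ H : ℂ × (ℂ × ℂ) → ℂ × ℂ,
        ContinuousOn H (T ×ˢ Metric.ball (0 : ℂ × ℂ) r) ∧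
        ∀ t ∈ T,
          H (t, 0) = 0 ∧
          (∀ p ∈ Metric.ball (0 : ℂ × ℂ) r, ∀ q ∈ Metric.ball (0 : ℂ × ℂ) r,
            L⁻¹ * ‖p - q‖ ≤ ‖H (t, p) - H (t, q)‖ ∧
            ‖H (t, p) - H (t, q)‖ ≤ L * ‖p - q‖) ∧
          ((fun p => H (t, p)) '' Metric.ball (0 : ℂ × ℂ) r ∈ nhds (0 : ℂ × ℂ)) ∧
          ∀ p ∈ Metric.ball (0 : ℂ × ℂ) r,
            (fun (τ : ℂ) (w : ℂ × ℂ) => (w.1 ^ 2 + w.2 ^ 3) ^ 2 + s * w.1 ^ 2 * w.2 ^ (3 + q) + τ * w.1 ^ 2 * w.2 ^ (4 + q)) t (H (t, p)) =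
            (fun (τ : ℂ) (w : ℂ × ℂ) => (w.1 ^ 2 + w.2 ^ 3) ^ 2 + s * w.1 ^ 2 * w.2 ^ (3 + q) + τ * w.1 ^ 2 * w.2 ^ (4 + q)) t₀ p := by
  obtain ⟨K, U, hU, hV⟩ := isLipschitzNear_trivializingField hq hs t₀
  have hne : {w | fieldDenom q s w ≠ 0} ∈ 𝓝 (t₀, (0 : ℂ × ℂ)) :=
    contDiff_fieldDenom.continuous.continuousAt.eventually_ne (fieldDenom_ne_zero hq hs t₀)
  obtain ⟨T, hT, r, hr, H, hcont, hH⟩ := exists_flow_of_lipschitzOnWith (inter_mem hU hne)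
    (hV.mono inter_subset_left) trivializingField_zero
  refine ⟨T, hT, r, 2, hr, one_le_two, H, hcont, fun t ht ↦ ?_⟩
  obtain ⟨hzero, hclose, hpath⟩ := hH t ht
  refine ⟨hzero, fun p hp p' hp' ↦ ?_, ?_, fun p hp ↦ ?_⟩
  · have h := hclose p hp p' hp'
    have h₁ := norm_le_norm_add_norm_sub (H (t, p) - H (t, p')) (p - p')
    have h₂ := norm_le_norm_add_norm_sub' (H (t, p) - H (t, p')) (p - p')
    constructor <;> linarith [norm_nonneg (p - p')]
  · have happrox : ApproximatesLinearOn (fun p ↦ H (t, p))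
        (ContinuousLinearEquiv.refl ℂ (ℂ × ℂ) : ℂ × ℂ →L[ℂ] ℂ × ℂ) (ball 0 r) (1 / 2) :=
      fun p hp p' hp' ↦ by simpa using hclose p hp p' hp'
    have himage := happrox.image_mem_nhds
      (ContinuousLinearEquiv.refl ℂ (ℂ × ℂ)).toNonlinearRightInverse
      (ball_mem_nhds _ hr) (Or.inr ?_)
    · simpa only [hzero] using himage
    · change (1 / 2 : ℝ≥0) < ‖ContinuousLinearMap.id ℂ (ℂ × ℂ)‖₊⁻¹
      have hnorm : ‖ContinuousLinearMap.id ℂ (ℂ × ℂ)‖₊ = 1 :=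
        NNReal.eq ContinuousLinearMap.norm_id
      rw [hnorm, inv_one]
      exact NNReal.half_lt_self one_ne_zero
  · obtain ⟨γ, hγ0, hγ1, hγ⟩ := hpath p hp
    have htime (τ : ℝ) : HasDerivWithinAt (fun τ : ℝ ↦ t₀ + τ * (t - t₀)) (t - t₀) (Icc 0 1) τ := by
      simpa using ((Complex.ofRealCLM.hasDerivAt (x := τ)).hasDerivWithinAt.mul_const
        (t - t₀)).const_add t₀
    have hderiv (τ : ℝ) (hτ : τ ∈ Icc (0 : ℝ) 1) :
        HasDerivWithinAt (fun τ : ℝ ↦ ((γ τ).1 ^ 2 + (γ τ).2 ^ 3) ^ 2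
          + s * (γ τ).1 ^ 2 * (γ τ).2 ^ (3 + q)
          + (t₀ + τ * (t - t₀)) * (γ τ).1 ^ 2 * (γ τ).2 ^ (4 + q)) 0 (Icc 0 1) τ := by
      obtain ⟨⟨-, hQ⟩, hd⟩ := hγ τ hτ
      have hd₁ := (ContinuousLinearMap.fst ℝ ℂ ℂ).hasFDerivAt.comp_hasDerivWithinAt τ hd
      have hd₂ := (ContinuousLinearMap.snd ℝ ℂ ℂ).hasFDerivAt.comp_hasDerivWithinAt τ hd
      refine (hasDerivWithinAt_family (htime τ) hd₁ hd₂).congr_deriv ?_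
      have hann := trivializingField_annihilates (x := (γ τ).1) (y := (γ τ).2) hQ
      simp only [Function.comp_apply, ContinuousLinearMap.coe_fst', ContinuousLinearMap.coe_snd',
        Prod.smul_fst, Prod.smul_snd, smul_eq_mul]
      linear_combination (t - t₀) * hann
    have hconst := norm_image_sub_le_of_norm_deriv_le_segment_01' hderiv
      (C := 0) (fun _ _ ↦ norm_zero.le)
    have heq := sub_eq_zero.1 (norm_le_zero_iff.1 hconst)
    simpa [hγ0, hγ1] using heq
end
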